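/- arXiv:2508.17277 — 2 statements merged into one kernel-verified Lean document; each statement's English description precedes it below -/
import Mathlib

section
/- There exists a constant c > 0 such that every set of n ≥ 2 points in the plane in general position contains a crossing family of size at least n / 2^{c·√(log₂ n)}. -/
open scoped Classical

/-- Points in the plane. -/
abbrev Pt := ℝ × ℝ

/-- A finite planar point set is in general position if no three of its points are collinear. -/
def GenPos (P : Finset Pt) : Prop :=
  ∀ p ∈ P, ∀ q ∈ P, ∀ r ∈ P, p ≠ q → p ≠ r → q ≠ r → ¬ Collinear ℝ ({p, q, r} : Set Pt)

/-- Two closed segments cross: their intersection is a single point lying in the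
relative interior (open segment) of both. -/
def SegCross (s t : Pt × Pt) : Prop :=
  ∃ x : Pt, segment ℝ s.1 s.2 ∩ segment ℝ t.1 t.2 = {x} ∧
    x ∈ openSegment ℝ s.1 s.2 ∧ x ∈ openSegment ℝ t.1 t.2

/-- A crossing family of size `k` in `P`: `k` segments with endpoints in `P`, pairwise crossing. -/
def CrossingFamily (P : Finset Pt) (k : ℕ) : Prop :=
  ∃ F : Finset (Pt × Pt), F.card = k ∧ (∀ e ∈ F, e.1 ∈ P ∧ e.2 ∈ P) ∧
    ∀ e ∈ F, ∀ f ∈ F, e ≠ f → SegCross e f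

/-- A non-crossing family of size `m` in `P`. -/
def NonCrossingFamily (P : Finset Pt) (m : ℕ) : Prop :=
  ∃ P₁ P₂ P₃ P₄ : Finset Pt,
    P₁ ⊆ P ∧ P₂ ⊆ P ∧ P₃ ⊆ P ∧ P₄ ⊆ P ∧
    Disjoint P₁ P₂ ∧ Disjoint P₁ P₃ ∧ Disjoint P₁ P₄ ∧
    Disjoint P₂ P₃ ∧ Disjoint P₂ P₄ ∧ Disjoint P₃ P₄ ∧
    m ≤ P₁.card ∧ m ≤ P₂.card ∧ m ≤ P₃.card ∧ m ≤ P₄.card ∧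
    ∀ p₁ ∈ P₁, ∀ p₂ ∈ P₂, ∀ p₃ ∈ P₃, ∀ p₄ ∈ P₄,
      p₄ ∈ interior (convexHull ℝ ({p₁, p₂, p₃} : Set Pt))

/-- A point set is in convex position if no point lies in the convex hull of the others. -/
def ConvexPos (S : Set Pt) : Prop := ∀ p ∈ S, p ∉ convexHull ℝ (S \ {p})

/-- A convex bundle of size `k` and width `m` in `P`. -/
def ConvexBundle (P : Finset Pt) (k m : ℕ) : Prop :=
  ∃ C : Fin k → Finset Pt, (∀ i, C i ⊆ P) ∧
    (∀ i j, i ≠ j → Disjoint (C i) (C j)) ∧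
    (∀ i, m ≤ (C i).card) ∧
    ∀ f : Fin k → Pt, (∀ i, f i ∈ C i) → ConvexPos (Set.range f)

/-- Two finite point sets are separated if their convex hulls are disjoint. -/
def Separated (A B : Finset Pt) : Prop :=
  Disjoint (convexHull ℝ (A : Set Pt)) (convexHull ℝ (B : Set Pt))

/-- A line in the plane, given by an equation `a * x + b * y = c` with `(a, b) ≠ (0, 0)`. -/
structure Line where
  a : ℝ
  b : ℝ
  c : ℝ
  nondeg : a ≠ 0 ∨ b ≠ 0

/-- The set of points of a line. -/
def Line.toSet (L : Line) : Set Pt := {x | L.a * x.1 + L.b * x.2 = L.c}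

/-- Two lines are parallel if their normal vectors are proportional. -/
def Line.Parallel (L M : Line) : Prop := L.a * M.b - L.b * M.a = 0

/-- A spoke set of size `k` in `P`: `k` pairwise non-parallel lines such that every unbounded
cell of their arrangement (unbounded connected component of the complement of their union)
contains a point of `P`. -/
def SpokeSet (P : Finset Pt) (k : ℕ) : Prop :=
  ∃ ℓ : Fin k → Line,
    (∀ i j, i ≠ j → ¬ (ℓ i).Parallel (ℓ j)) ∧
    ∀ x : Pt, x ∈ (⋃ i, (ℓ i).toSet)ᶜ →
      ¬ Bornology.IsBounded (connectedComponentIn (⋃ i, (ℓ i).toSet)ᶜ x) →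
      ∃ p ∈ P, p ∈ connectedComponentIn (⋃ i, (ℓ i).toSet)ᶜ x

/-- `b` lies strictly to the left of the line through `x` and `y`, oriented from `x` to `y`. -/
def LeftOf (x y b : Pt) : Prop :=
  0 < (y.1 - x.1) * (b.2 - x.2) - (y.2 - x.2) * (b.1 - x.1)

/-- The relation `<_B`: `x <_B y` iff `B` is contained in the open half-plane to the left of
the line through `x` and `y` oriented from `x` towards `y`. -/
def LtRel (B : Finset Pt) (x y : Pt) : Prop :=
  x ≠ y ∧ ∀ b ∈ B, LeftOf x y b

/-- `x` and `y` are incomparable in `<_B`. -/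
def Incomp (B : Finset Pt) (x y : Pt) : Prop := ¬ LtRel B x y ∧ ¬ LtRel B y x

/-- `ι(A, <_B)`: the number of unordered pairs of distinct points of `A`
that are incomparable in `<_B`. -/
noncomputable def iota (A B : Finset Pt) : ℕ :=
  Set.ncard {s : Finset Pt | ∃ x y : Pt, x ≠ y ∧ s = {x, y} ∧ x ∈ A ∧ y ∈ A ∧ Incomp B x y}

/-- `A` and `B` (two `m`-element sets) form an `ε`-avoiding pair. -/
def EpsAvoiding (ε : ℝ) (m : ℕ) (A B : Finset Pt) : Prop :=
  ((iota A B : ℝ) + (iota B A : ℝ)) ≤ ε * (m : ℝ) ^ 2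

/-- The zone of a line `ℓ` in the arrangement of the lines `ℓs`: the union of all cells
(connected components of the complement) whose closure meets `ℓ`. -/
noncomputable def Zone (r : ℕ) (ℓs : Fin r → Line) (ℓ : Line) : Set Pt :=
  {y | ∃ x ∈ (⋃ i, (ℓs i).toSet)ᶜ,
    y ∈ connectedComponentIn (⋃ i, (ℓs i).toSet)ᶜ x ∧
    (closure (connectedComponentIn (⋃ i, (ℓs i).toSet)ᶜ x) ∩ ℓ.toSet).Nonempty}

/-! ### Orientation determinant -/

/-- Orientation determinant of three points. -/
def det3 (x y b : Pt) : ℝ := (y.1 - x.1) * (b.2 - x.2) - (y.2 - x.2) * (b.1 - x.1)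

/-- Point on the segment from `b` to `c`. -/
def mixPt (t : ℝ) (b c : Pt) : Pt := ((1 - t) * b.1 + t * c.1, (1 - t) * b.2 + t * c.2)

lemma det3_rot (x y z : Pt) : det3 x y z = det3 y z x := by unfold det3; ring

lemma det3_swap (x y z : Pt) : det3 x y z = - det3 y x z := by unfold det3; ring

lemma det3_mix (x y b c : Pt) (t : ℝ) :
    det3 x y (mixPt t b c) = (1 - t) * det3 x y b + t * det3 x y c := by
  unfold det3 mixPt; ring

lemma combo_pos {t u v : ℝ} (h0 : 0 ≤ t) (h1 : t ≤ 1) (hu : 0 < u) (hv : 0 < v) :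
    0 < (1 - t) * u + t * v := by
  rcases eq_or_lt_of_le h0 with h | h
  · subst h; simpa using hu
  · have := mul_pos h hv
    have := mul_nonneg (sub_nonneg.2 h1) hu.le
    linarith

/-- Separation by a linear functional. -/
def LSep (A B : Finset Pt) : Prop :=
  ∃ u v : ℝ, ∀ a ∈ A, ∀ b ∈ B, u * a.1 + v * a.2 < u * b.1 + v * b.2

lemma LSep.symm {A B : Finset Pt} (h : LSep A B) : LSep B A := by
  obtain ⟨u, v, h⟩ := h
  refine ⟨-u, -v, fun a ha b hb => ?_⟩
  have := h b hb a ha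
  linarith

lemma LSep.mono {A B A' B' : Finset Pt} (h : LSep A B) (hA : A' ⊆ A) (hB : B' ⊆ B) :
    LSep A' B' := by
  obtain ⟨u, v, h⟩ := h
  exact ⟨u, v, fun a ha b hb => h a (hA ha) b (hB hb)⟩

lemma ltRel_trans {A B : Finset Pt} (h : LSep A B) (hB : B.Nonempty) {x y z : Pt}
    (hx : x ∈ A) (hy : y ∈ A) (hz : z ∈ A) (hxy : LtRel B x y) (hyz : LtRel B y z) :
    LtRel B x z := by
  obtain ⟨u, v, h⟩ := h
  have key : ∀ b ∈ B, LeftOf x z b := by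
    intro b hb
    have h1 := hxy.2 b hb
    have h2 := hyz.2 b hb
    have fx := h x hx b hb
    have fy := h y hy b hb
    have fz := h z hz b hb
    unfold LeftOf at *
    set fx' := u * (b.1 - x.1) + v * (b.2 - x.2) with hfx
    set fy' := u * (b.1 - y.1) + v * (b.2 - y.2) with hfy
    set fz' := u * (b.1 - z.1) + v * (b.2 - z.2) with hfz
    have px : 0 < fx' := by rw [hfx]; linarith
    have py : 0 < fy' := by rw [hfy]; linarith
    have pz : 0 < fz' := by rw [hfz]; linarith
    have e : fy' * ((z.1 - x.1) * (b.2 - x.2) - (z.2 - x.2) * (b.1 - x.1)) =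
      fx' * ((z.1 - y.1) * (b.2 - y.2) - (z.2 - y.2) * (b.1 - y.1)) +
      fz' * ((y.1 - x.1) * (b.2 - x.2) - (y.2 - x.2) * (b.1 - x.1)) := by
      rw [hfx, hfy, hfz]; ring
    have : 0 < fy' * ((z.1 - x.1) * (b.2 - x.2) - (z.2 - x.2) * (b.1 - x.1)) := by
      rw [e]; exact add_pos (mul_pos px h2) (mul_pos pz h1)
    exact pos_of_mul_pos_right this py.le
  refine ⟨?_, key⟩
  rintro rfl
  obtain ⟨b, hb⟩ := hB
  have := key b hb
  unfold LeftOf at this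
  linarith

lemma incomp_mono {B B' : Finset Pt} (h : B' ⊆ B) {x y : Pt} (hi : Incomp B' x y) :
    Incomp B x y :=
  ⟨fun hl => hi.1 ⟨hl.1, fun b hb => hl.2 b (h hb)⟩,
   fun hl => hi.2 ⟨hl.1, fun b hb => hl.2 b (h hb)⟩⟩

lemma incomp_hit {B : Finset Pt} {x y : Pt} (hxy : x ≠ y) (hi : Incomp B x y) :
    ∃ b ∈ B, ∃ c ∈ B, ∃ t : ℝ, 0 ≤ t ∧ t ≤ 1 ∧ det3 x y (mixPt t b c) = 0 := by
  obtain ⟨h1, h2⟩ := hi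
  unfold LtRel at h1 h2
  push Not at h1 h2
  obtain ⟨b, hb, hb'⟩ := h1 hxy
  obtain ⟨c, hc, hc'⟩ := h2 hxy.symm
  have hb1 : det3 x y b ≤ 0 := by unfold LeftOf at hb'; unfold det3; linarith
  have hc1 : 0 ≤ det3 x y c := by
    rw [det3_swap]; unfold LeftOf at hc'; unfold det3; linarith
  by_cases h0 : det3 x y c - det3 x y b = 0
  · refine ⟨b, hb, c, hc, 0, le_rfl, zero_le_one, ?_⟩
    rw [det3_mix]
    have : det3 x y b = 0 := by linarith
    rw [this]; ring
  · have hp : 0 < det3 x y c - det3 x y b := lt_of_le_of_ne (by linarith) (Ne.symm h0)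
    refine ⟨b, hb, c, hc, (- det3 x y b) / (det3 x y c - det3 x y b), ?_, ?_, ?_⟩
    · exact div_nonneg (by linarith) hp.le
    · rw [div_le_one hp]; linarith
    · rw [det3_mix]; field_simp; ring

/-- Three points on the line through `x ≠ y` have zero determinant. -/
lemma det3_zero_of_line {x y p q r : Pt} (hxy : x ≠ y) (hp : det3 x y p = 0)
    (hq : det3 x y q = 0) (hr : det3 x y r = 0) : det3 p q r = 0 := by
  have h : y.1 - x.1 ≠ 0 ∨ y.2 - x.2 ≠ 0 := by
    by_contra hc
    push Not at hc
    exact hxy (Prod.ext (by linarith [hc.1]) (by linarith [hc.2]))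
  unfold det3 at *
  rcases h with h | h
  · apply (mul_eq_zero.1 (?_ : (y.1 - x.1) * _ = 0)).resolve_left h
    linear_combination (q.1 - p.1) * (hr - hp) - (r.1 - p.1) * (hq - hp)
  · apply (mul_eq_zero.1 (?_ : (y.2 - x.2) * _ = 0)).resolve_left h
    linear_combination (q.2 - p.2) * (hr - hp) - (r.2 - p.2) * (hq - hp)

lemma not_hit_two {A B C : Finset Pt} {x y : Pt} (hx : x ∈ A) (hxy : x ≠ y)
    (h : ∀ b ∈ B, ∀ c ∈ C, LtRel A b c) (hB : Incomp B x y) (hC : Incomp C x y) : False := by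
  obtain ⟨b, hb, b', hb', t, t0, t1, ht⟩ := incomp_hit hxy hB
  obtain ⟨c, hc, c', hc', s, s0, s1, hs⟩ := incomp_hit hxy hC
  have hz := det3_zero_of_line hxy ht hs (show det3 x y x = 0 by unfold det3; ring)
  have pos : ∀ b ∈ B, ∀ c ∈ C, 0 < det3 b c x := fun b hb c hc => (h b hb c hc).2 x hx
  have p1 : ∀ b ∈ B, 0 < det3 b (mixPt s c c') x := by
    intro b hb
    rw [det3_rot, det3_rot, det3_mix]
    refine combo_pos s0 s1 ?_ ?_
    · rw [← det3_rot, ← det3_rot]; exact pos b hb c hc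
    · rw [← det3_rot, ← det3_rot]; exact pos b hb c' hc'
  have p2 : 0 < det3 (mixPt t b b') (mixPt s c c') x := by
    rw [det3_rot, det3_mix]
    refine combo_pos t0 t1 ?_ ?_
    · rw [← det3_rot]; exact p1 b hb
    · rw [← det3_rot]; exact p1 b' hb'
  linarith

lemma not_hit_three {B C D : Finset Pt} {x y : Pt} (hxy : x ≠ y)
    (h : ∀ b ∈ B, ∀ c ∈ C, ∀ d ∈ D, 0 < det3 b c d) (hB : Incomp B x y) (hC : Incomp C x y)
    (hD : Incomp D x y) : False := by
  obtain ⟨b, hb, b', hb', t, t0, t1, ht⟩ := incomp_hit hxy hB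
  obtain ⟨c, hc, c', hc', s, s0, s1, hs⟩ := incomp_hit hxy hC
  obtain ⟨d, hd, d', hd', w, w0, w1, hw⟩ := incomp_hit hxy hD
  have hz := det3_zero_of_line hxy ht hs hw
  have p0 : ∀ b ∈ B, ∀ c ∈ C, 0 < det3 b c (mixPt w d d') := by
    intro b hb c hc
    rw [det3_mix]
    exact combo_pos w0 w1 (h b hb c hc d hd) (h b hb c hc d' hd')
  have p1 : ∀ b ∈ B, 0 < det3 b (mixPt s c c') (mixPt w d d') := by
    intro b hb
    rw [det3_rot, det3_rot, det3_mix]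
    refine combo_pos s0 s1 ?_ ?_
    · rw [← det3_rot, ← det3_rot]; exact p0 b hb c hc
    · rw [← det3_rot, ← det3_rot]; exact p0 b hb c' hc'
  have p2 : 0 < det3 (mixPt t b b') (mixPt s c c') (mixPt w d d') := by
    rw [det3_rot, det3_mix]
    refine combo_pos t0 t1 ?_ ?_
    · rw [← det3_rot]; exact p1 b hb
    · rw [← det3_rot]; exact p1 b' hb'
  linarith

/-- Convex quadrilateral `a a' b b'`: the diagonals cross. -/
lemma segCross_of_det {a a' b b' : Pt} (h1 : 0 < det3 a a' b) (h2 : 0 < det3 a a' b')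
    (h3 : 0 < det3 b b' a) (h4 : 0 < det3 b b' a') : SegCross (a, b) (a', b') := by
  have hs : 0 < det3 a a' b' + det3 b b' a' := by linarith
  have hs2 : det3 a a' b + det3 b b' a = det3 a a' b' + det3 b b' a' := by unfold det3; ring
  set D := det3 a a' b' + det3 b b' a' with hD
  have hDne : D ≠ 0 := hs.ne'
  set t := det3 a a' b' / D with ht
  set s := det3 a a' b / D with hs'
  have t0 : 0 < t := div_pos h2 hs
  have t1 : t < 1 := by rw [ht, div_lt_one hs]; linarith
  have s0 : 0 < s := div_pos h1 hs
  have s1 : s < 1 := by rw [hs', div_lt_one hs]; linarith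
  have e : mixPt t a b = mixPt s a' b' := by
    have htD : t * D = det3 a a' b' := by rw [ht]; field_simp
    have hsD : s * D = det3 a a' b := by rw [hs']; field_simp
    unfold mixPt
    refine Prod.ext ?_ ?_
    · apply mul_right_cancel₀ hDne
      have : D * (a.1 - a'.1) + (t * D) * (b.1 - a.1) - (s * D) * (b'.1 - a'.1) = 0 := by
        rw [htD, hsD, hD]; unfold det3; ring
      simp only
      linarith
    · apply mul_right_cancel₀ hDne
      have : D * (a.2 - a'.2) + (t * D) * (b.2 - a.2) - (s * D) * (b'.2 - a'.2) = 0 := by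
        rw [htD, hsD, hD]; unfold det3; ring
      simp only
      linarith
  have mixeq : ∀ (w : ℝ) (p q : Pt), mixPt w p q = (1 - w) • p + w • q := by
    intro w p q; unfold mixPt; ext <;> simp
  have o1 : mixPt t a b ∈ openSegment ℝ a b :=
    ⟨1 - t, t, by linarith, t0, by ring, (mixeq _ _ _).symm⟩
  have o2 : mixPt t a b ∈ openSegment ℝ a' b' := by
    rw [e]; exact ⟨1 - s, s, by linarith, s0, by ring, (mixeq _ _ _).symm⟩
  refine ⟨mixPt t a b, ?_, o1, o2⟩
  apply Set.eq_singleton_iff_unique_mem.2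
  refine ⟨⟨openSegment_subset_segment ℝ _ _ o1, openSegment_subset_segment ℝ _ _ o2⟩, ?_⟩
  rintro z ⟨⟨u1, w1, -, -, q1, rfl⟩, ⟨u2, w2, -, -, q2, hz⟩⟩
  have hu1 : u1 = 1 - w1 := by linarith
  have hu2 : u2 = 1 - w2 := by linarith
  subst hu1 hu2
  rw [← mixeq, ← mixeq] at *
  have ex := congrArg Prod.fst hz
  have ey := congrArg Prod.snd hz
  simp only [mixPt] at ex ey
  have : w1 = t := by
    rw [ht, eq_div_iff hDne, hD]
    unfold det3
    linear_combination (-(b'.2 - a'.2)) * ex + (b'.1 - a'.1) * ey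
  rw [this]

/-! ### Blocks in partial orders with few incomparable pairs -/

lemma exists_downset {α : Type*} [DecidableEq α] (r : α → α → Prop) (A : Finset α)
    (irr : ∀ x, ¬ r x x) (tr : ∀ x ∈ A, ∀ y ∈ A, ∀ z ∈ A, r x y → r y z → r x z)
    (s : ℕ) (hs : s ≤ A.card) :
    ∃ T ⊆ A, T.card = s ∧ ∀ t ∈ T, ∀ u ∈ A \ T, ¬ r u t := by
  induction s with
  | zero => exact ⟨∅, by simp, by simp, by simp⟩
  | succ s ih =>
    obtain ⟨T, hT, hc, hd⟩ := ih (by omega)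
    have hne : (A \ T).Nonempty := by
      rw [← Finset.card_pos, Finset.card_sdiff_of_subset hT]; omega
    obtain ⟨u, hu, hmin⟩ := Finset.exists_min_image (A \ T)
      (fun u => (A.filter (fun w => r w u)).card) hne
    have huA := (Finset.mem_sdiff.1 hu).1
    have huT := (Finset.mem_sdiff.1 hu).2
    refine ⟨insert u T, Finset.insert_subset huA hT, by
      rw [Finset.card_insert_of_notMem huT, hc], ?_⟩
    intro t ht w hw hwt
    rw [Finset.mem_sdiff, Finset.mem_insert, not_or] at hw
    obtain ⟨hwA, hwu, hwT⟩ := hw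
    rcases Finset.mem_insert.1 ht with rfl | ht
    · have := hmin w (Finset.mem_sdiff.2 ⟨hwA, hwT⟩)
      have hlt : (A.filter (fun v => r v w)).card < (A.filter (fun v => r v t)).card := by
        apply Finset.card_lt_card
        rw [Finset.ssubset_iff_of_subset]
        · exact ⟨w, by simp [hwA, hwt], by simp [irr]⟩
        · intro v hv
          rw [Finset.mem_filter] at hv ⊢
          exact ⟨hv.1, tr v hv.1 w hwA t huA hv.2 hwt⟩
      omega
    · exact hd t ht w (Finset.mem_sdiff.2 ⟨hwA, hwT⟩) hwt

lemma exists_blocks {α : Type*} [DecidableEq α] (r : α → α → Prop) (irr : ∀ x, ¬ r x x) (d h : ℕ) (N : ℕ) :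
    ∀ A : Finset α, (∀ x ∈ A, ∀ y ∈ A, ∀ z ∈ A, r x y → r y z → r x z) →
      (∀ x ∈ A, (A.filter (fun y => x ≠ y ∧ ¬ r x y ∧ ¬ r y x)).card ≤ d) →
      N * (h + 2 * d + 1) ≤ A.card →
      ∃ C : ℕ → Finset α, (∀ i < N, C i ⊆ A ∧ (C i).card = h) ∧
        ∀ i j, i < j → j < N → ∀ x ∈ C i, ∀ y ∈ C j, r x y := by
  induction N with
  | zero => intro A _ _ _; exact ⟨fun _ => ∅, by simp, by simp⟩
  | succ N ih =>
    intro A tr hdeg hcard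
    have hcard' : N * (h + 2 * d + 1) + (h + 2 * d + 1) ≤ A.card := by
      rw [add_mul, one_mul] at hcard; exact hcard
    obtain ⟨T, hT, hTc, hTd⟩ := exists_downset r A irr tr h (by omega)
    have hA1 : (A \ T).card = A.card - h := by rw [Finset.card_sdiff_of_subset hT, hTc]
    have hsub1 : A \ T ⊆ A := Finset.sdiff_subset
    obtain ⟨G, hG, hGc, hGd⟩ := exists_downset r (A \ T) irr
      (fun x hx y hy z hz => tr x (hsub1 hx) y (hsub1 hy) z (hsub1 hz)) (2 * d + 1) (by omega)
    have hA2 : ((A \ T) \ G).card = A.card - h - (2 * d + 1) := by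
      rw [Finset.card_sdiff_of_subset hG, hGc, hA1]
    have hsub2 : (A \ T) \ G ⊆ A := Finset.sdiff_subset.trans hsub1
    obtain ⟨C, hC1, hC2⟩ := ih ((A \ T) \ G)
      (fun x hx y hy z hz => tr x (hsub2 hx) y (hsub2 hy) z (hsub2 hz))
      (fun x hx => (Finset.card_le_card (Finset.filter_subset_filter _ hsub2)).trans
        (hdeg x (hsub2 hx))) (by omega)
    refine ⟨fun i => Nat.casesOn i T C, ?_, ?_⟩
    · intro i hi
      cases i with
      | zero => exact ⟨hT, hTc⟩
      | succ i =>
        have := hC1 i (by omega)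
        exact ⟨this.1.trans hsub2, this.2⟩
    · intro i j hij hj x hx y hy
      cases j with
      | zero => omega
      | succ j =>
        have hyC : y ∈ C j := hy
        have hyA2 := (hC1 j (by omega)).1 hyC
        cases i with
        | succ i => exact hC2 i j (by omega) (by omega) x hx y hy
        | zero =>
          have hxT : x ∈ T := hx
          have hxA := hT hxT
          have hyA := hsub2 hyA2
          have hex : ∃ z ∈ G, z ∉ (A.filter (fun z => x ≠ z ∧ ¬ r x z ∧ ¬ r z x)) ∪
              (A.filter (fun z => y ≠ z ∧ ¬ r y z ∧ ¬ r z y)) := by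
            by_contra hcon
            push Not at hcon
            have := Finset.card_le_card (show G ⊆ _ from hcon)
            have h2 := this.trans (Finset.card_union_le _ _)
            have := hdeg x hxA
            have := hdeg y hyA
            omega
          obtain ⟨z, hzG, hz⟩ := hex
          have hzAT := hG hzG
          have hzA := hsub1 hzAT
          rw [Finset.mem_union, not_or, Finset.mem_filter, Finset.mem_filter] at hz
          have hxz : x ≠ z := by
            rintro rfl; exact (Finset.mem_sdiff.1 hzAT).2 hxT
          have hyz : y ≠ z := by
            rintro rfl; exact (Finset.mem_sdiff.1 hyA2).2 hzG
          have n1 : ¬ r z x := hTd x hxT z hzAT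
          have n2 : ¬ r y z := hGd z hzG y hyA2
          have r1 : r x z := by
            by_contra hh; exact hz.1 ⟨hzA, hxz, hh, n1⟩
          have r2 : r z y := by
            by_contra hh; exact hz.2 ⟨hzA, hyz, n2, hh⟩
          exact tr x hxA z hzA y hyA r1 r2

/-- Number of ordered pairs of distinct points of `A` incomparable with respect to `B`. -/
noncomputable def J (A B : Finset Pt) : ℕ :=
  ((A ×ˢ A).filter (fun p => p.1 ≠ p.2 ∧ Incomp B p.1 p.2)).card

/-- Blocks from a pair with few incomparable pairs. -/
lemma blocks_of_J {A B : Finset Pt} (hS : LSep A B) (hB : B.Nonempty) {N h : ℕ} (hh : 1 ≤ h)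
    (hA : A.card = 4 * N * h) (hJ : 2 * J A B ≤ 2 * N * h * h) :
    ∃ C : ℕ → Finset Pt, (∀ i < N, C i ⊆ A ∧ (C i).card = h) ∧
        ∀ i j, i < j → j < N → ∀ x ∈ C i, ∀ y ∈ C j, LtRel B x y := by
  set d := (h - 1) / 2 with hd
  set deg : Pt → ℕ := fun x => (A.filter (fun y => x ≠ y ∧ Incomp B x y)).card with hdegdef
  set A' := A.filter (fun x => deg x ≤ d) with hA'
  set A'' := A.filter (fun x => ¬ deg x ≤ d) with hA''
  have hsum : A'.card + A''.card = A.card :=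
    Finset.card_filter_add_card_filter_not (fun x => deg x ≤ d)
  have hJsum : J A B = ∑ x ∈ A, deg x := by
    unfold J
    rw [Finset.card_filter, Finset.sum_product]
    refine Finset.sum_congr rfl fun x _ => ?_
    rw [hdegdef]
    simp only
    rw [Finset.card_filter]
  have hbig : A''.card * (d + 1) ≤ J A B := by
    rw [hJsum]
    calc A''.card * (d + 1) = ∑ x ∈ A'', (d + 1) := by simp
      _ ≤ ∑ x ∈ A'', deg x := Finset.sum_le_sum fun x hx => by
          have := (Finset.mem_filter.1 hx).2
          omega
      _ ≤ ∑ x ∈ A, deg x := Finset.sum_le_sum_of_subset (Finset.filter_subset _ _)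
  have hd2 : h ≤ 2 * (d + 1) := by omega
  have hA2 : A''.card ≤ 2 * N * h := by
    have : A''.card * h ≤ 2 * N * h * h := by
      calc A''.card * h ≤ A''.card * (2 * (d + 1)) := Nat.mul_le_mul_left _ hd2
        _ = 2 * (A''.card * (d + 1)) := by ring
        _ ≤ 2 * J A B := by omega
        _ ≤ _ := hJ
    exact Nat.le_of_mul_le_mul_right this (by omega)
  have hA1 : 2 * N * h ≤ A'.card := by
    have : 4 * N * h = 2 * N * h + 2 * N * h := by ring
    omega
  have hsub : A' ⊆ A := Finset.filter_subset _ _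
  obtain ⟨C, hC1, hC2⟩ := exists_blocks (LtRel B) (fun x hx => hx.1 rfl) d h N A'
    (fun x hx y hy z hz h1 h2 => ltRel_trans hS hB (hsub hx) (hsub hy) (hsub hz) h1 h2)
    (fun x hx => by
      refine le_trans (Finset.card_le_card ?_) (Finset.mem_filter.1 hx).2
      intro y hy
      rw [Finset.mem_filter] at hy ⊢
      exact ⟨hsub hy.1, hy.2.1, hy.2.2⟩)
    (by
      calc N * (h + 2 * d + 1) ≤ N * (2 * h) := Nat.mul_le_mul_left _ (by omega)
        _ = 2 * N * h := by ring
        _ ≤ _ := hA1)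
  exact ⟨C, fun i hi => ⟨(hC1 i hi).1.trans hsub, (hC1 i hi).2⟩, hC2⟩

/-- Sum over block pairs of incomparable pairs. -/
lemma sum_J_le {A B : Finset Pt} (S : Finset (ℕ × ℕ)) (f g : ℕ × ℕ → ℕ)
    (hinj : ∀ p ∈ S, ∀ q ∈ S, f p = f q → g p = g q → p = q) {C D : ℕ → Finset Pt}
    (hC : ∀ p ∈ S, C (f p) ⊆ A) (hD : ∀ p ∈ S, D (g p) ⊆ B)
    (hCd : ∀ p ∈ S, ∀ q ∈ S, f p < f q → ∀ x ∈ C (f p), ∀ y ∈ C (f q), LtRel B x y)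
    (hDd : ∀ p ∈ S, ∀ q ∈ S, g p < g q → ∀ x ∈ D (g p), ∀ y ∈ D (g q), LtRel A x y) :
    ∑ p ∈ S, J (C (f p)) (D (g p)) ≤ J A B := by
  unfold J
  rw [← Finset.card_biUnion]
  · apply Finset.card_le_card
    intro q hq
    rw [Finset.mem_biUnion] at hq
    obtain ⟨p, hp, hq⟩ := hq
    rw [Finset.mem_filter, Finset.mem_product] at hq ⊢
    exact ⟨⟨hC p hp hq.1.1, hC p hp hq.1.2⟩, hq.2.1, incomp_mono (hD p hp) hq.2.2⟩
  · intro p hp q hq hpq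
    rw [Function.onFun, Finset.disjoint_left]
    intro z hz1 hz2
    rw [Finset.mem_filter, Finset.mem_product] at hz1 hz2
    have e1 : f p = f q := by
      rcases lt_trichotomy (f p) (f q) with h | h | h
      · exact absurd rfl (hCd p hp q hq h _ hz1.1.1 _ hz2.1.1).1
      · exact h
      · exact absurd rfl (hCd q hq p hp h _ hz2.1.1 _ hz1.1.1).1
    have e2 : g p = g q := by
      have hzA := hC p hp hz1.1.1
      rcases lt_trichotomy (g p) (g q) with h | h | h
      · exact (not_hit_two hzA hz1.2.1 (hDd p hp q hq h) hz1.2.2 hz2.2.2).elim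
      · exact h
      · exact (not_hit_two hzA hz1.2.1 (hDd q hq p hp h) hz2.2.2 hz1.2.2).elim
    exact hpq (hinj p hp q hq e1 e2)

/-! ### The recursion -/

lemma SegCross.symm' {s t : Pt × Pt} (h : SegCross s t) : SegCross t s := by
  obtain ⟨x, h1, h2, h3⟩ := h
  exact ⟨x, by rw [Set.inter_comm]; exact h1, h3, h2⟩

lemma exists_small_shift {n : ℕ} (hn : 1 ≤ n) (V : ℕ → ℕ → ℝ) (E : ℝ)
    (h : ∑ s ∈ Finset.range n, ∑ i ∈ Finset.range n, V i s ≤ E) :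
    ∃ s ∈ Finset.range n, (n : ℝ) * ∑ i ∈ Finset.range n, V i s ≤ E := by
  by_contra hc
  push Not at hc
  have hne : (Finset.range n).Nonempty := Finset.nonempty_range_iff.2 (by omega)
  have h1 := Finset.sum_lt_sum_of_nonempty hne hc
  rw [← Finset.mul_sum] at h1
  simp only [Finset.sum_const, Finset.card_range, nsmul_eq_mul] at h1
  have hn' : (0 : ℝ) < n := by exact_mod_cast hn
  have := (mul_lt_mul_iff_right₀ hn').1 h1
  linarith

lemma exists_good {K : ℕ} (V : ℕ → ℝ) (hV : ∀ i, 0 ≤ V i) (T : ℝ) (hT : 0 ≤ T)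
    (h : ∑ i ∈ Finset.range (2 * K), V i ≤ K * T) :
    ∃ G ⊆ Finset.range (2 * K), G.card = K ∧ ∀ i ∈ G, V i ≤ T := by
  set good := (Finset.range (2 * K)).filter (fun i => V i ≤ T) with hgood
  set bad := (Finset.range (2 * K)).filter (fun i => ¬ V i ≤ T) with hbad
  have hsum : good.card + bad.card = (Finset.range (2 * K)).card :=
    Finset.card_filter_add_card_filter_not (fun i => V i ≤ T)
  rw [Finset.card_range] at hsum
  have hle : K ≤ good.card := by
    by_contra hlt
    have hb : K < bad.card := by omega
    have hne : bad.Nonempty := Finset.card_pos.1 (by omega)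
    have h1 : ∑ i ∈ bad, T < ∑ i ∈ bad, V i :=
      Finset.sum_lt_sum_of_nonempty hne fun i hi => not_le.1 (Finset.mem_filter.1 hi).2
    have h2 : ∑ i ∈ bad, V i ≤ ∑ i ∈ Finset.range (2 * K), V i :=
      Finset.sum_le_sum_of_subset_of_nonneg (Finset.filter_subset _ _) fun i _ _ => hV i
    simp only [Finset.sum_const, nsmul_eq_mul] at h1
    have h3 : (K : ℝ) * T ≤ bad.card * T := by
      apply mul_le_mul_of_nonneg_right _ hT
      exact_mod_cast hb.le
    linarith
  obtain ⟨G, hG, hc⟩ := Finset.exists_subset_card_eq hle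
  exact ⟨G, hG.trans (Finset.filter_subset _ _), hc, fun i hi => (Finset.mem_filter.1 (hG hi)).2⟩

theorem crossing_rec (K : ℕ) (hK : 1 ≤ K) (L : ℕ) : ∀ (A B : Finset Pt) (ε : ℝ), 0 ≤ ε →
    LSep A B → A.card = (16 * K) ^ L → B.card = (16 * K) ^ L →
    (J A B : ℝ) + J B A ≤ ε * ((16 * K : ℝ) ^ L) ^ 2 → ε * 128 ^ L * K ≤ 1 →
    ∃ F : Finset (Pt × Pt), F.card = K ^ L ∧ (∀ e ∈ F, e.1 ∈ A ∧ e.2 ∈ B) ∧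
      ∀ e ∈ F, ∀ f ∈ F, e ≠ f → SegCross e f := by
  induction L with
  | zero =>
    intro A B ε _ _ hA hB _ _
    obtain ⟨a, rfl⟩ := Finset.card_eq_one.1 (by simpa using hA)
    obtain ⟨b, rfl⟩ := Finset.card_eq_one.1 (by simpa using hB)
    refine ⟨{(a, b)}, by simp, by simp, ?_⟩
    intro e he f hf hne
    rw [Finset.mem_singleton] at he hf
    exact absurd (he.trans hf.symm) hne
  | succ L ih =>
    intro A B ε hε hS hA hB hJ hεK
    set h := (16 * K) ^ L with hh
    have hh1 : 1 ≤ h := Nat.one_le_pow _ _ (by omega)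
    have hKr : (1 : ℝ) ≤ K := by exact_mod_cast hK
    have hhr : ((16 * K : ℝ)) ^ L = h := by rw [hh]; push_cast; rfl
    have hhr1 : (1 : ℝ) ≤ h := by exact_mod_cast hh1
    rw [pow_succ (16 * (K : ℝ)) L, hhr] at hJ
    have hεK' : ε * 128 * K ≤ 1 := by
      refine le_trans ?_ hεK
      have : (1 : ℝ) ≤ 128 ^ L := one_le_pow₀ (by norm_num)
      rw [pow_succ]
      have h2 : 0 ≤ ε * 128 * K := by positivity
      nlinarith
    have hJ2 : (J A B : ℝ) + J B A ≤ 4 * K * h * h := by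
      refine hJ.trans ?_
      have : ε * ((h : ℝ) * (16 * K)) ^ 2 = (ε * 128 * K) * (2 * K * h * h) := by ring
      rw [this]
      have : (0 : ℝ) ≤ 2 * K * h * h := by positivity
      nlinarith
    have hJ3 : J A B + J B A ≤ 4 * K * h * h := by exact_mod_cast hJ2
    have hA' : A.card = 4 * (4 * K) * h := by rw [hA, pow_succ, ← hh]; ring
    have hB' : B.card = 4 * (4 * K) * h := by rw [hB, pow_succ, ← hh]; ring
    have hpos : 0 < 4 * (4 * K) * h := by positivity
    have hAne : A.Nonempty := Finset.card_pos.1 (by omega)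
    have hBne : B.Nonempty := Finset.card_pos.1 (by omega)
    have e8 : 2 * (4 * K) * h * h = 2 * (4 * K * h * h) := by ring
    obtain ⟨C, hC1, hC2⟩ := blocks_of_J hS hBne hh1 hA' (by omega)
    obtain ⟨D, hD1, hD2⟩ := blocks_of_J hS.symm hAne hh1 hB' (by omega)
    set V : ℕ → ℕ → ℝ := fun i s => (J (C i) (D (i + s)) : ℝ) + J (D (i + s)) (C i) with hV
    set S := Finset.range (2 * K) ×ˢ Finset.range (2 * K) with hSdef
    have hS1 : ∀ p ∈ S, p.1 < 2 * K ∧ p.2 < 2 * K := by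
      intro p hp
      rw [hSdef, Finset.mem_product, Finset.mem_range, Finset.mem_range] at hp
      exact hp
    have s1 : ∑ p ∈ S, J (C p.1) (D (p.1 + p.2)) ≤ J A B := by
      refine sum_J_le S (fun p => p.1) (fun p => p.1 + p.2) ?_ ?_ ?_ ?_ ?_
      · intro p _ q _ h1 h2
        exact Prod.ext h1 (by omega)
      · intro p hp; exact (hC1 _ (by have := hS1 p hp; omega)).1
      · intro p hp; exact (hD1 _ (by have := hS1 p hp; omega)).1
      · intro p hp q hq hlt; exact hC2 _ _ hlt (by have := hS1 q hq; omega)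
      · intro p hp q hq hlt; exact hD2 _ _ hlt (by have := hS1 q hq; omega)
    have s2 : ∑ p ∈ S, J (D (p.1 + p.2)) (C p.1) ≤ J B A := by
      refine sum_J_le S (fun p => p.1 + p.2) (fun p => p.1) ?_ ?_ ?_ ?_ ?_
      · intro p _ q _ h1 h2
        exact Prod.ext h2 (by omega)
      · intro p hp; exact (hD1 _ (by have := hS1 p hp; omega)).1
      · intro p hp; exact (hC1 _ (by have := hS1 p hp; omega)).1
      · intro p hp q hq hlt; exact hD2 _ _ hlt (by have := hS1 q hq; omega)
      · intro p hp q hq hlt; exact hC2 _ _ hlt (by have := hS1 q hq; omega)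
    have s3 : ∑ s ∈ Finset.range (2 * K), ∑ i ∈ Finset.range (2 * K), V i s ≤
        ε * ((h : ℝ) * (16 * K)) ^ 2 := by
      refine le_trans ?_ hJ
      rw [Finset.sum_comm, ← Finset.sum_product']
      rw [hV]
      simp only
      rw [Finset.sum_add_distrib]
      exact add_le_add (by exact_mod_cast s1) (by exact_mod_cast s2)
    obtain ⟨s, hs, hsum⟩ := exists_small_shift (by omega) V _ s3
    rw [Finset.mem_range] at hs
    have hsum' : ∑ i ∈ Finset.range (2 * K), V i s ≤ K * (128 * ε * (h : ℝ) ^ 2) := by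
      push_cast at hsum
      have h2K : (0 : ℝ) < 2 * K := by linarith
      apply le_of_mul_le_mul_left _ h2K
      refine hsum.trans (le_of_eq ?_)
      ring
    obtain ⟨G, hG, hGc, hGV⟩ := exists_good (fun i => V i s)
      (fun i => by simp only [hV]; positivity) (128 * ε * (h : ℝ) ^ 2) (by positivity) hsum'
    have hG' : ∀ i ∈ G, i < 2 * K := fun i hi => Finset.mem_range.1 (hG hi)
    have hex : ∀ i, ∃ F : Finset (Pt × Pt), i ∈ G → (F.card = K ^ L ∧
        (∀ e ∈ F, e.1 ∈ C i ∧ e.2 ∈ D (i + s)) ∧ ∀ e ∈ F, ∀ f ∈ F, e ≠ f → SegCross e f) := by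
      intro i
      by_cases hi : i ∈ G
      · have hi2 := hG' i hi
        have c1 := hC1 i (by omega)
        have d1 := hD1 (i + s) (by omega)
        obtain ⟨F, hF⟩ := ih (C i) (D (i + s)) (128 * ε) (by positivity)
          (hS.mono c1.1 d1.1) c1.2 d1.2 (by rw [hhr]; exact hGV i hi) (by
            rw [pow_succ] at hεK
            linarith)
        exact ⟨F, fun _ => hF⟩
      · exact ⟨∅, fun hi' => absurd hi' hi⟩
    choose F hF using hex
    have cross : ∀ i ∈ G, ∀ j ∈ G, i < j → ∀ e ∈ F i, ∀ f ∈ F j, SegCross e f := by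
      intro i hi j hj hij e he f hf
      have hj2 := hG' j hj
      have hi2 := hG' i hi
      obtain ⟨ea, eb⟩ := (hF i hi).2.1 e he
      obtain ⟨fa, fb⟩ := (hF j hj).2.1 f hf
      have r1 := hC2 i j hij (by omega) _ ea _ fa
      have r2 := hD2 (i + s) (j + s) (by omega) (by omega) _ eb _ fb
      have ea' := (hC1 i (by omega)).1 ea
      have fa' := (hC1 j (by omega)).1 fa
      have eb' := (hD1 (i + s) (by omega)).1 eb
      have fb' := (hD1 (j + s) (by omega)).1 fb
      exact segCross_of_det (r1.2 _ eb') (r1.2 _ fb') (r2.2 _ ea') (r2.2 _ fa')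
    refine ⟨G.biUnion F, ?_, ?_, ?_⟩
    · rw [Finset.card_biUnion]
      · rw [Finset.sum_congr rfl (fun i hi => (hF i hi).1)]
        simp [hGc, pow_succ, mul_comm]
      · have dis : ∀ i ∈ G, ∀ j ∈ G, i < j → Disjoint (F i) (F j) := by
          intro i hi j hj hij
          rw [Finset.disjoint_left]
          intro e he he'
          have hj2 := hG' j hj
          exact (hC2 i j hij (by omega) _ ((hF i hi).2.1 e he).1 _ ((hF j hj).2.1 e he').1).1 rfl
        intro i hi j hj hij
        rcases lt_or_gt_of_ne hij with hlt | hlt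
        · exact dis i hi j hj hlt
        · exact (dis j hj i hi hlt).symm
    · intro e he
      obtain ⟨i, hi, he⟩ := Finset.mem_biUnion.1 he
      have hi2 := hG' i hi
      have := (hF i hi).2.1 e he
      exact ⟨(hC1 i (by omega)).1 this.1, (hD1 (i + s) (by omega)).1 this.2⟩
    · intro e he f hf hef
      obtain ⟨i, hi, he⟩ := Finset.mem_biUnion.1 he
      obtain ⟨j, hj, hf⟩ := Finset.mem_biUnion.1 hf
      rcases lt_trichotomy i j with hlt | heq | hlt
      · exact cross i hi j hj hlt e he f hf
      · subst heq
        exact (hF i hi).2.2 e he f hf hef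
      · exact (cross j hj i hi hlt f hf e he).symm'

/-! ### Three sets in fixed orientation -/

lemma exists_kth (S : Finset Pt) (h : ℕ) (h1 : 1 ≤ h) (h2 : h ≤ S.card) :
    ∃ φ : ℝ → ℝ, Continuous φ ∧ ∀ σ : ℝ,
      h ≤ (S.filter (fun p => p.2 - σ * p.1 ≤ φ σ)).card ∧
      (S.filter (fun p => p.2 - σ * p.1 < φ σ)).card < h := by
  have hne : ∀ T : {T // T ∈ S.powersetCard h}, T.1.Nonempty := by
    intro T
    have := (Finset.mem_powersetCard.1 T.2).2
    exact Finset.card_pos.1 (by omega)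
  have hne2 : (S.powersetCard h).attach.Nonempty := by
    rw [Finset.attach_nonempty_iff]
    exact Finset.powersetCard_nonempty.2 h2
  refine ⟨fun σ => (S.powersetCard h).attach.inf' hne2
    (fun T => T.1.sup' (hne T) (fun p => p.2 - σ * p.1)), ?_, ?_⟩
  · apply Continuous.finset_inf'_apply
    intro T _
    apply Continuous.finset_sup'_apply
    intro p _
    fun_prop
  · intro σ
    constructor
    · obtain ⟨T, -, hT⟩ := Finset.exists_mem_eq_inf' hne2
        (fun T : {T // T ∈ S.powersetCard h} => T.1.sup' (hne T) (fun p => p.2 - σ * p.1))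
      simp only
      rw [hT]
      obtain ⟨hs, hc⟩ := Finset.mem_powersetCard.1 T.2
      refine le_trans hc.ge (Finset.card_le_card ?_)
      intro p hp
      rw [Finset.mem_filter]
      refine ⟨hs hp, ?_⟩
      exact Finset.le_sup' (fun p : Pt => p.2 - σ * p.1) hp
    · by_contra hcon
      push Not at hcon
      obtain ⟨T, hT, hTc⟩ := Finset.exists_subset_card_eq hcon
      have hmem : T ∈ S.powersetCard h :=
        Finset.mem_powersetCard.2 ⟨hT.trans (Finset.filter_subset _ _), hTc⟩
      have a1 := Finset.inf'_le
        (fun T : {T // T ∈ S.powersetCard h} => T.1.sup' (hne T) (fun p => p.2 - σ * p.1))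
        (Finset.mem_attach _ ⟨T, hmem⟩)
      have a2 : T.sup' (hne ⟨T, hmem⟩) (fun p => p.2 - σ * p.1) <
          (S.powersetCard h).attach.inf' hne2
            (fun T => T.1.sup' (hne T) (fun p => p.2 - σ * p.1)) := by
        rw [Finset.sup'_lt_iff]
        intro p hp
        exact (Finset.mem_filter.1 (hT hp)).2
      exact absurd a1 (not_le.2 a2)

lemma ham_sandwich (L R : Finset Pt) (h : ℕ) (h1 : 1 ≤ h) (hL : h ≤ L.card) (hR : h ≤ R.card)
    (hx : ∀ l ∈ L, ∀ r ∈ R, l.1 < r.1) :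
    ∃ σ t : ℝ, (h ≤ (L.filter (fun p => p.2 - σ * p.1 ≤ t)).card ∧
      (L.filter (fun p => p.2 - σ * p.1 < t)).card < h) ∧
      (h ≤ (R.filter (fun p => p.2 - σ * p.1 ≤ t)).card ∧
      (R.filter (fun p => p.2 - σ * p.1 < t)).card < h) := by
  obtain ⟨φ, hφc, hφ⟩ := exists_kth L h h1 hL
  obtain ⟨ψ, hψc, hψ⟩ := exists_kth R h h1 hR
  have low : ∀ (S : Finset Pt) (χ : ℝ → ℝ) (σ : ℝ),
      h ≤ (S.filter (fun p => p.2 - σ * p.1 ≤ χ σ)).card →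
      ∃ p ∈ S, p.2 - σ * p.1 ≤ χ σ := by
    intro S χ σ hc
    obtain ⟨p, hp⟩ := Finset.card_pos.1 (lt_of_lt_of_le h1 hc)
    exact ⟨p, (Finset.mem_filter.1 hp).1, (Finset.mem_filter.1 hp).2⟩
  have high : ∀ (S : Finset Pt) (χ : ℝ → ℝ) (σ : ℝ), h ≤ S.card →
      (S.filter (fun p => p.2 - σ * p.1 < χ σ)).card < h →
      ∃ p ∈ S, χ σ ≤ p.2 - σ * p.1 := by
    intro S χ σ hS hc
    by_contra hcon
    push Not at hcon
    rw [Finset.filter_true_of_mem hcon] at hc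
    omega
  set Q := (L ×ˢ R).image (fun z => (z.2.2 - z.1.2) / (z.2.1 - z.1.1)) with hQ
  obtain ⟨M, hM⟩ := Q.exists_le
  obtain ⟨m, hm⟩ : ∃ m : ℝ, ∀ i ∈ Q, m ≤ i := Finset.exists_le (α := ℝᵒᵈ) Q
  have hq : ∀ l ∈ L, ∀ r ∈ R, (r.2 - l.2) / (r.1 - l.1) ∈ Q := fun l hl r hr =>
    Finset.mem_image.2 ⟨(l, r), Finset.mem_product.2 ⟨hl, hr⟩, rfl⟩
  have c1 : ψ M - φ M ≤ 0 := by
    obtain ⟨l, hl, hl'⟩ := low L φ M (hφ M).1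
    obtain ⟨r, hr, hr'⟩ := high R ψ M hR (hψ M).2
    have := hM _ (hq l hl r hr)
    have hp : 0 < r.1 - l.1 := sub_pos.2 (hx l hl r hr)
    rw [div_le_iff₀ hp] at this
    linarith
  have c2 : 0 ≤ ψ m - φ m := by
    obtain ⟨l, hl, hl'⟩ := high L φ m hL (hφ m).2
    obtain ⟨r, hr, hr'⟩ := low R ψ m (hψ m).1
    have := hm _ (hq l hl r hr)
    have hp : 0 < r.1 - l.1 := sub_pos.2 (hx l hl r hr)
    have := (le_div_iff₀ hp).1 this
    linarith
  obtain ⟨σ, hσ⟩ := mem_range_of_exists_le_of_exists_ge (hψc.sub hφc) ⟨M, c1⟩ ⟨m, c2⟩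
  have e : φ σ = ψ σ := by
    have hσ' : ψ σ - φ σ = 0 := hσ
    linarith
  refine ⟨σ, φ σ, hφ σ, ?_⟩
  rw [e]
  exact hψ σ

lemma card_line_le_two {P : Finset Pt} (hP : GenPos P) (S : Finset Pt) (hS : S ⊆ P) (σ t : ℝ)
    (h : ∀ p ∈ S, p.2 - σ * p.1 = t) : S.card ≤ 2 := by
  by_contra hc
  push Not at hc
  obtain ⟨a, b, c, ha, hb, hc', hab, hac, hbc⟩ := Finset.two_lt_card_iff.1 hc
  apply hP a (hS ha) b (hS hb) c (hS hc') hab hac hbc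
  rw [collinear_iff_exists_forall_eq_smul_vadd]
  refine ⟨(0, t), (1, σ), ?_⟩
  intro p hp
  have hp' : p ∈ S := by
    rcases hp with rfl | rfl | rfl
    · exact ha
    · exact hb
    · exact hc'
  refine ⟨p.1, ?_⟩
  have := h p hp'
  refine Prod.ext ?_ ?_
  · simp
  · simp; linarith

lemma not_same_x {P : Finset Pt} (hP : GenPos P) {a b c : Pt} (ha : a ∈ P) (hb : b ∈ P)
    (hc : c ∈ P) (hab : a ≠ b) (hac : a ≠ c) (hbc : b ≠ c) (h1 : a.1 = b.1) (h2 : a.1 = c.1) :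
    False := by
  apply hP a ha b hb c hc hab hac hbc
  rw [collinear_iff_exists_forall_eq_smul_vadd]
  refine ⟨(a.1, 0), (0, 1), ?_⟩
  intro p hp
  refine ⟨p.2, ?_⟩
  have : p.1 = a.1 := by
    rcases hp with rfl | rfl | rfl
    · rfl
    · exact h1.symm
    · exact h2.symm
  refine Prod.ext ?_ ?_
  · simp [this]
  · simp

lemma three_sets {P : Finset Pt} (hP : GenPos P) (m : ℕ) (hm : 1 ≤ m) (hc : 18 * m ≤ P.card) :
    ∃ X Y Z : Finset Pt, (X ⊆ P ∧ m ≤ X.card) ∧ (Y ⊆ P ∧ m ≤ Y.card) ∧ (Z ⊆ P ∧ m ≤ Z.card) ∧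
      LSep X Y ∧ LSep X Z ∧ LSep Y Z ∧ ∀ x ∈ X, ∀ y ∈ Y, ∀ z ∈ Z, 0 < det3 x y z := by
  set r : Pt → Pt → Prop := fun p q => p.1 < q.1 with hr
  have irr : ∀ x, ¬ r x x := fun x => lt_irrefl _
  have tr : ∀ x y z, r x y → r y z → r x z := fun x y z h1 h2 => lt_trans h1 h2
  obtain ⟨L, hL, hLc, hLd⟩ := exists_downset r P irr (fun x _ y _ z _ => tr x y z) (2 * m + 4)
    (by omega)
  have c1 : (P \ L).card = P.card - (2 * m + 4) := by rw [Finset.card_sdiff_of_subset hL, hLc]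
  obtain ⟨M, hM, hMc, hMd⟩ := exists_downset r (P \ L) irr (fun x _ y _ z _ => tr x y z)
    (2 * m + 4) (by omega)
  have c2 : ((P \ L) \ M).card = P.card - (2 * m + 4) - (2 * m + 4) := by
    rw [Finset.card_sdiff_of_subset hM, hMc, c1]
  obtain ⟨R, hR, hRc⟩ := Finset.exists_subset_card_eq
    (show 2 * m + 4 ≤ ((P \ L) \ M).card by omega)
  have hMP : M ⊆ P := hM.trans Finset.sdiff_subset
  have hRP : R ⊆ P := (hR.trans Finset.sdiff_subset).trans Finset.sdiff_subset
  have lm : ∀ l ∈ L, ∀ q ∈ M, l.1 ≤ q.1 := fun l hl q hq => not_lt.1 (hLd l hl q (hM hq))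
  have mr : ∀ q ∈ M, ∀ w ∈ R, q.1 ≤ w.1 := fun q hq w hw => not_lt.1 (hMd q hq w (hR hw))
  have lr : ∀ l ∈ L, ∀ w ∈ R, l.1 < w.1 := by
    intro l hl w hw
    obtain ⟨q, hq⟩ := Finset.card_pos.1 (show 0 < M.card by omega)
    by_contra hcon
    push Not at hcon
    have h1 := lm l hl q hq
    have h2 := mr q hq w hw
    have hql : l ≠ q := by
      rintro rfl; exact (Finset.mem_sdiff.1 (hM hq)).2 hl
    have hqw : q ≠ w := by
      rintro rfl; exact (Finset.mem_sdiff.1 (hR hw)).2 hq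
    have hlw : l ≠ w := by
      rintro rfl
      exact (Finset.mem_sdiff.1 (Finset.mem_sdiff.1 (hR hw)).1).2 hl
    exact not_same_x hP (hL hl) (hMP hq) (hRP hw) hql hlw hqw (by linarith) (by linarith)
  obtain ⟨σ, t, ⟨l1, l2⟩, ⟨r1, r2⟩⟩ := ham_sandwich L R (m + 2) (by omega) (by omega) (by omega) lr
  have split : ∀ S : Finset Pt, S ⊆ P →
      (S.filter (fun p => p.2 - σ * p.1 ≤ t)).card ≤
        (S.filter (fun p => p.2 - σ * p.1 < t)).card + 2 ∧
      S.card ≤ (S.filter (fun p => p.2 - σ * p.1 ≤ t)).card +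
        (S.filter (fun p => t < p.2 - σ * p.1)).card := by
    intro S hS
    constructor
    · have h2 : (S.filter (fun p => p.2 - σ * p.1 = t)).card ≤ 2 :=
        card_line_le_two hP _ ((Finset.filter_subset _ _).trans hS) σ t
          fun p hp => (Finset.mem_filter.1 hp).2
      refine le_trans (le_trans (Finset.card_le_card (?_ : _ ⊆
        (S.filter (fun p => p.2 - σ * p.1 < t)) ∪ (S.filter (fun p => p.2 - σ * p.1 = t))))
        (Finset.card_union_le _ _)) (by omega)
      intro p hp
      rw [Finset.mem_filter] at hp
      rw [Finset.mem_union, Finset.mem_filter, Finset.mem_filter]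
      rcases lt_or_eq_of_le hp.2 with h | h
      · exact Or.inl ⟨hp.1, h⟩
      · exact Or.inr ⟨hp.1, h⟩
    · refine le_trans (Finset.card_le_card (?_ : _ ⊆
        (S.filter (fun p => p.2 - σ * p.1 ≤ t)) ∪ (S.filter (fun p => t < p.2 - σ * p.1))))
        (Finset.card_union_le _ _)
      intro p hp
      rw [Finset.mem_union, Finset.mem_filter, Finset.mem_filter]
      rcases le_or_gt (p.2 - σ * p.1) t with h | h
      · exact Or.inl ⟨hp, h⟩
      · exact Or.inr ⟨hp, h⟩
  have sL := split L hL
  have sM := split M hMP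
  have sR := split R hRP
  have fs : ∀ (S : Finset Pt) (q : Pt → Prop), S ⊆ P → S.filter q ⊆ P := fun S q hS =>
    (Finset.filter_subset _ _).trans hS
  have sepLR : LSep L R := ⟨1, 0, fun a ha b hb => by have := lr a ha b hb; linarith⟩
  have sepf : ∀ S T : Finset Pt, LSep (S.filter (fun p => p.2 - σ * p.1 < t))
      (T.filter (fun p => t < p.2 - σ * p.1)) := by
    intro S T
    refine ⟨-σ, 1, fun a ha b hb => ?_⟩
    have h1 := (Finset.mem_filter.1 ha).2
    have h2 := (Finset.mem_filter.1 hb).2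
    linarith
  have hdet : ∀ l w q : Pt, det3 l w q = (q.2 - σ * q.1 - t) * (w.1 - l.1)
      - (l.2 - σ * l.1 - t) * (w.1 - q.1) - (w.2 - σ * w.1 - t) * (q.1 - l.1) := by
    intro l w q; unfold det3; ring
  by_cases hMM : m ≤ (M.filter (fun p => t < p.2 - σ * p.1)).card
  · refine ⟨L.filter (fun p => p.2 - σ * p.1 < t), R.filter (fun p => p.2 - σ * p.1 < t),
      M.filter (fun p => t < p.2 - σ * p.1), ⟨fs _ _ hL, by omega⟩, ⟨fs _ _ hRP, by omega⟩,
      ⟨fs _ _ hMP, hMM⟩, sepLR.mono (Finset.filter_subset _ _) (Finset.filter_subset _ _),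
      sepf _ _, sepf _ _, ?_⟩
    intro l hl w hw q hq
    rw [Finset.mem_filter] at hl hw hq
    have a1 := lr l hl.1 w hw.1
    have a2 := lm l hl.1 q hq.1
    have a3 := mr q hq.1 w hw.1
    rw [hdet]
    have b1 : 0 < (q.2 - σ * q.1 - t) * (w.1 - l.1) :=
      mul_pos (by linarith [hq.2]) (by linarith)
    have b2 : (l.2 - σ * l.1 - t) * (w.1 - q.1) ≤ 0 :=
      mul_nonpos_of_nonpos_of_nonneg (by linarith [hl.2]) (by linarith)
    have b3 : (w.2 - σ * w.1 - t) * (q.1 - l.1) ≤ 0 :=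
      mul_nonpos_of_nonpos_of_nonneg (by linarith [hw.2]) (by linarith)
    linarith
  · refine ⟨R.filter (fun p => t < p.2 - σ * p.1), L.filter (fun p => t < p.2 - σ * p.1),
      M.filter (fun p => p.2 - σ * p.1 < t), ⟨fs _ _ hRP, by omega⟩, ⟨fs _ _ hL, by omega⟩,
      ⟨fs _ _ hMP, by omega⟩,
      sepLR.symm.mono (Finset.filter_subset _ _) (Finset.filter_subset _ _),
      (sepf _ _).symm, (sepf _ _).symm, ?_⟩
    intro w hw l hl q hq
    rw [Finset.mem_filter] at hl hw hq
    have a1 := lr l hl.1 w hw.1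
    have a2 := lm l hl.1 q hq.1
    have a3 := mr q hq.1 w hw.1
    rw [det3_swap, hdet]
    have b1 : (q.2 - σ * q.1 - t) * (w.1 - l.1) < 0 :=
      mul_neg_of_neg_of_pos (by linarith [hq.2]) (by linarith)
    have b2 : 0 ≤ (l.2 - σ * l.1 - t) * (w.1 - q.1) :=
      mul_nonneg (by linarith [hl.2]) (by linarith)
    have b3 : 0 ≤ (w.2 - σ * w.1 - t) * (q.1 - l.1) :=
      mul_nonneg (by linarith [hw.2]) (by linarith)
    linarith

/-! ### Partition with low crossing number and the initial pair -/

lemma GenPos.mono {P Q : Finset Pt} (h : GenPos P) (hQ : Q ⊆ P) : GenPos Q :=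
  fun p hp q hq r hr => h p (hQ hp) q (hQ hq) r (hQ hr)

lemma exists_family (m : ℕ) (hm : 1 ≤ m) (d : ℕ) : ∀ P : Finset Pt, GenPos P →
    18 ^ d * m ≤ P.card → ∃ (ι : Type) (_ : Fintype ι) (Q : ι → Finset Pt),
      Fintype.card ι = 3 ^ d ∧ (∀ i, Q i ⊆ P ∧ (Q i).card = m) ∧
      (∀ i j, i ≠ j → LSep (Q i) (Q j)) ∧
      ∀ x y, x ≠ y → (Finset.univ.filter (fun i => Incomp (Q i) x y)).card ≤ 2 ^ d := by
  induction d with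
  | zero =>
    intro P hP hc
    obtain ⟨T, hT, hTc⟩ := Finset.exists_subset_card_eq (show m ≤ P.card by simpa using hc)
    refine ⟨Unit, inferInstance, fun _ => T, by simp, fun _ => ⟨hT, hTc⟩, ?_, ?_⟩
    · intro i j hij; exact absurd (Subsingleton.elim i j) hij
    · intro x y _
      exact (Finset.card_filter_le _ _).trans (by simp)
  | succ d ih =>
    intro P hP hc
    have h18 : 1 ≤ 18 ^ d * m := Nat.mul_pos (by positivity) hm
    obtain ⟨X, Y, Z, ⟨hX, hXc⟩, ⟨hY, hYc⟩, ⟨hZ, hZc⟩, sXY, sXZ, sYZ, hdet⟩ :=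
      three_sets hP (18 ^ d * m) h18 (by rw [pow_succ] at hc; linarith)
    obtain ⟨ι₁, f₁, Q₁, k₁, a₁, s₁, c₁⟩ := ih X (hP.mono hX) hXc
    obtain ⟨ι₂, f₂, Q₂, k₂, a₂, s₂, c₂⟩ := ih Y (hP.mono hY) hYc
    obtain ⟨ι₃, f₃, Q₃, k₃, a₃, s₃, c₃⟩ := ih Z (hP.mono hZ) hZc
    refine ⟨ι₁ ⊕ (ι₂ ⊕ ι₃), inferInstance, Sum.elim Q₁ (Sum.elim Q₂ Q₃), ?_, ?_, ?_, ?_⟩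
    · rw [Fintype.card_sum, Fintype.card_sum, k₁, k₂, k₃, pow_succ]; ring
    · rintro (i | i | i)
      · exact ⟨(a₁ i).1.trans hX, (a₁ i).2⟩
      · exact ⟨(a₂ i).1.trans hY, (a₂ i).2⟩
      · exact ⟨(a₃ i).1.trans hZ, (a₃ i).2⟩
    · rintro (i | i | i) (j | j | j) hij
      · exact s₁ i j (fun h => hij (by rw [h]))
      · exact sXY.mono (a₁ i).1 (a₂ j).1
      · exact sXZ.mono (a₁ i).1 (a₃ j).1
      · exact sXY.symm.mono (a₂ i).1 (a₁ j).1
      · exact s₂ i j (fun h => hij (by rw [h]))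
      · exact sYZ.mono (a₂ i).1 (a₃ j).1
      · exact sXZ.symm.mono (a₃ i).1 (a₁ j).1
      · exact sYZ.symm.mono (a₃ i).1 (a₂ j).1
      · exact s₃ i j (fun h => hij (by rw [h]))
    · intro x y hxy
      have b₁ := c₁ x y hxy
      have b₂ := c₂ x y hxy
      have b₃ := c₃ x y hxy
      rw [Finset.card_filter, Fintype.sum_sum_type, Fintype.sum_sum_type]
      change (∑ i, if Incomp (Q₁ i) x y then 1 else 0) +
        ((∑ i, if Incomp (Q₂ i) x y then 1 else 0) +
          (∑ i, if Incomp (Q₃ i) x y then 1 else 0)) ≤ _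
      rw [← Finset.card_filter, ← Finset.card_filter, ← Finset.card_filter, pow_succ]
      have zero : ∀ (κ : Type) [Fintype κ] (Q : κ → Finset Pt) (W : Finset Pt),
          (∀ i, Q i ⊆ W) → ¬ Incomp W x y →
          (Finset.univ.filter (fun i => Incomp (Q i) x y)).card = 0 := by
        intro κ _ Q W hQ hW
        rw [Finset.card_eq_zero, Finset.filter_eq_empty_iff]
        intro i _ hi
        exact hW (incomp_mono (hQ i) hi)
      by_cases iX : Incomp X x y
      · by_cases iY : Incomp Y x y
        · by_cases iZ : Incomp Z x y
          · exact (not_hit_three hxy hdet iX iY iZ).elim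
          · have := zero ι₃ Q₃ Z (fun i => (a₃ i).1) iZ
            omega
        · have := zero ι₂ Q₂ Y (fun i => (a₂ i).1) iY
          omega
      · have := zero ι₁ Q₁ X (fun i => (a₁ i).1) iX
        omega

lemma exists_pair (m : ℕ) (hm : 1 ≤ m) (d : ℕ) (hd : 1 ≤ d) (P : Finset Pt) (hP : GenPos P)
    (hc : 18 ^ d * m ≤ P.card) : ∃ A B : Finset Pt, A ⊆ P ∧ B ⊆ P ∧ A.card = m ∧ B.card = m ∧
      LSep A B ∧ (3 ^ d - 1) * (J A B + J B A) ≤ 2 * 2 ^ d * m ^ 2 := by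
  obtain ⟨ι, fι, Q, kι, hQ, hS, hcr⟩ := exists_family m hm d P hP hc
  have row : ∀ i, ∑ j, J (Q i) (Q j) ≤ m ^ 2 * 2 ^ d := by
    intro i
    unfold J
    simp_rw [Finset.card_filter]
    rw [Finset.sum_comm]
    have : m ^ 2 * 2 ^ d = ∑ p ∈ Q i ×ˢ Q i, 2 ^ d := by
      rw [Finset.sum_const, Finset.card_product, (hQ i).2, smul_eq_mul]; ring
    rw [this]
    refine Finset.sum_le_sum fun p _ => ?_
    by_cases hp : p.1 = p.2
    · simp [hp]
    · rw [← Finset.card_filter]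
      refine le_trans (Finset.card_le_card ?_) (hcr p.1 p.2 hp)
      intro j hj
      rw [Finset.mem_filter] at hj ⊢
      exact ⟨hj.1, hj.2.2⟩
  have tot : ∑ i, ∑ j, J (Q i) (Q j) ≤ 3 ^ d * (m ^ 2 * 2 ^ d) := by
    refine (Finset.sum_le_sum fun i _ => row i).trans ?_
    rw [Finset.sum_const, Finset.card_univ, kι, smul_eq_mul]
  set O := (Finset.univ : Finset ι).offDiag with hO
  have hOc : O.card = 3 ^ d * (3 ^ d - 1) := by
    rw [hO, Finset.offDiag_card, Finset.card_univ, kι, Nat.mul_sub, mul_one]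
  have h3 : 3 ≤ 3 ^ d := by
    calc 3 = 3 ^ 1 := by norm_num
      _ ≤ 3 ^ d := Nat.pow_le_pow_right (by norm_num) hd
  have hOne : O.Nonempty := by
    rw [← Finset.card_pos, hOc]
    exact Nat.mul_pos (by omega) (by omega)
  have hOs : O ⊆ (Finset.univ ×ˢ Finset.univ : Finset (ι × ι)) := by
    intro p _; simp
  have t1 : ∑ p ∈ O, J (Q p.1) (Q p.2) ≤ 3 ^ d * (m ^ 2 * 2 ^ d) := by
    refine le_trans (Finset.sum_le_sum_of_subset hOs) ?_
    rw [Finset.sum_product]; exact tot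
  have t2 : ∑ p ∈ O, J (Q p.2) (Q p.1) ≤ 3 ^ d * (m ^ 2 * 2 ^ d) := by
    refine le_trans (Finset.sum_le_sum_of_subset hOs) ?_
    rw [Finset.sum_product, Finset.sum_comm]; exact tot
  have hex : ∃ p ∈ O, (3 ^ d - 1) * (J (Q p.1) (Q p.2) + J (Q p.2) (Q p.1)) ≤
      2 * 2 ^ d * m ^ 2 := by
    by_contra hcon
    push Not at hcon
    have hlt := Finset.sum_lt_sum_of_nonempty hOne hcon
    rw [Finset.sum_const, hOc, smul_eq_mul, ← Finset.mul_sum, Finset.sum_add_distrib] at hlt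
    have hle := Nat.mul_le_mul_left (3 ^ d - 1) (Nat.add_le_add t1 t2)
    have e : (3 ^ d - 1) * (3 ^ d * (m ^ 2 * 2 ^ d) + 3 ^ d * (m ^ 2 * 2 ^ d)) =
        3 ^ d * (3 ^ d - 1) * (2 * 2 ^ d * m ^ 2) := by ring
    rw [e] at hle
    exact absurd (lt_of_lt_of_le hlt hle) (lt_irrefl _)
  obtain ⟨p, hp, hle⟩ := hex
  have hne : p.1 ≠ p.2 := (Finset.mem_offDiag.1 hp).2.2
  exact ⟨Q p.1, Q p.2, (hQ _).1, (hQ _).1, (hQ _).2, (hQ _).2, hS _ _ hne, hle⟩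

/-- The main construction with explicit parameters. -/
lemma crossing_of_large (L M : ℕ) (hM : M ≤ L) (P : Finset Pt) (hP : GenPos P)
    (hc : 18 ^ (16 * L + 4) * (16 * 2 ^ L) ^ M ≤ P.card) :
    CrossingFamily P ((2 ^ L) ^ M) := by
  set m := (16 * 2 ^ L) ^ M with hmdef
  have hm : 1 ≤ m := Nat.one_le_pow _ _ (by positivity)
  obtain ⟨A, B, hA, hB, hAc, hBc, hS, hJ⟩ := exists_pair m hm (16 * L + 4) (by omega) P hP hc
  have hJr : (J A B : ℝ) + J B A ≤ 4 * (2 / 3) ^ (16 * L + 4) * (m : ℝ) ^ 2 := by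
    have h3 : 1 ≤ 3 ^ (16 * L + 4) := Nat.one_le_pow _ _ (by norm_num)
    have h3' : (3 : ℝ) ≤ 3 ^ (16 * L + 4) := by
      calc (3 : ℝ) = 3 ^ 1 := by norm_num
        _ ≤ 3 ^ (16 * L + 4) := pow_le_pow_right₀ (by norm_num) (by omega)
    have hJ' : ((3 : ℝ) ^ (16 * L + 4) - 1) * (J A B + J B A) ≤
        2 * 2 ^ (16 * L + 4) * (m : ℝ) ^ 2 := by
      have := (Nat.cast_le (α := ℝ)).2 hJ
      push_cast [Nat.cast_sub h3] at this
      exact this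
    rw [div_pow]
    set T := (3 : ℝ) ^ (16 * L + 4) with hT
    have hTpos : 0 < T := by linarith
    have hJ0 : (0 : ℝ) ≤ J A B + J B A := by positivity
    rw [show 4 * ((2 : ℝ) ^ (16 * L + 4) / T) * (m : ℝ) ^ 2 =
      (4 * 2 ^ (16 * L + 4) * (m : ℝ) ^ 2) / T by ring, le_div_iff₀ hTpos]
    nlinarith
  have hcast : ((16 * ((2 ^ L : ℕ) : ℝ)) ^ M) = (m : ℝ) := by rw [hmdef]; push_cast; rfl
  obtain ⟨F, hF1, hF2, hF3⟩ := crossing_rec (2 ^ L) (Nat.one_le_two_pow) M A B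
    (4 * (2 / 3) ^ (16 * L + 4)) (by positivity) hS hAc hBc (by rw [hcast]; exact hJr) (by
      push_cast
      have e1 : (2 / 3 : ℝ) ^ (16 * L + 4) ≤ (1 / 2) ^ (8 * L + 2) := by
        rw [show 16 * L + 4 = 2 * (8 * L + 2) by ring, pow_mul]
        exact pow_le_pow_left₀ (by norm_num) (by norm_num) _
      have e2 : (128 : ℝ) ^ M ≤ 128 ^ L := pow_le_pow_right₀ (by norm_num) hM
      calc 4 * (2 / 3 : ℝ) ^ (16 * L + 4) * 128 ^ M * 2 ^ L
          ≤ 4 * (1 / 2 : ℝ) ^ (8 * L + 2) * 128 ^ L * 2 ^ L := by gcongr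
        _ = ((1 / 2 : ℝ) ^ 8 * 128 * 2) ^ L := by
            rw [pow_add, pow_mul, mul_pow, mul_pow]; ring
        _ ≤ 1 := by norm_num)
  exact ⟨F, hF1, fun e he => ⟨hA (hF2 e he).1, hB (hF2 e he).2⟩, hF3⟩

/-- There exists a constant `c > 0` such that every set of `n ≥ 2` points in the
plane in general position contains a crossing family of size at least `n / 2^(c·√(log₂ n))`. -/
theorem stmt4 :
    ∃ c : ℝ, 0 < c ∧ ∀ P : Finset Pt, 2 ≤ P.card → GenPos P →
      ∃ k : ℕ, (P.card : ℝ) / 2 ^ (c * Real.sqrt (Real.logb 2 (P.card : ℝ))) ≤ (k : ℝ) ∧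
        CrossingFamily P k := by
  refine ⟨172, by norm_num, ?_⟩
  intro P hP2 hP
  set n := P.card with hn
  have hn2 : (2 : ℝ) ≤ n := by exact_mod_cast hP2
  have hnpos : (0 : ℝ) < n := by linarith
  have hlog1 : 1 ≤ Real.logb 2 (n : ℝ) := by
    rw [Real.le_logb_iff_rpow_le (by norm_num) hnpos]; simpa using hn2
  set q := Real.sqrt (Real.logb 2 (n : ℝ)) with hq
  have hq1 : 1 ≤ q := by rw [hq]; exact Real.one_le_sqrt.2 hlog1
  have hq2 : q * q = Real.logb 2 (n : ℝ) := Real.mul_self_sqrt (by linarith)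
  have hnq : (n : ℝ) = 2 ^ (q * q) := by
    rw [hq2, Real.rpow_logb (by norm_num) (by norm_num) hnpos]
  set L := ⌈q⌉₊ with hL
  have hL1 : q ≤ L := Nat.le_ceil q
  have hL2 : (L : ℝ) < q + 1 := Nat.ceil_lt_add_one (by linarith)
  have two1 : (1 : ℝ) < 2 := by norm_num
  by_cases hcase : L < 86
  · refine ⟨1, ?_, ?_⟩
    · rw [hnq, ← Real.rpow_sub (by norm_num)]
      have hLr : (L : ℝ) ≤ 85 := by exact_mod_cast (show L ≤ 85 by omega)
      have : (2 : ℝ) ^ (q * q - 172 * q) ≤ 2 ^ (0 : ℝ) :=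
        Real.rpow_le_rpow_of_exponent_le two1.le (by nlinarith)
      simpa using this
    · obtain ⟨p, hp⟩ := Finset.card_pos.1 (show 0 < P.card by omega)
      refine ⟨{(p, p)}, by simp, by simp [hp], ?_⟩
      intro e he f hf hne
      rw [Finset.mem_singleton] at he hf
      exact absurd (he.trans hf.symm) hne
  · push Not at hcase
    obtain ⟨M, hM⟩ := Nat.exists_eq_add_of_le hcase
    have hMr : (L : ℝ) = 86 + M := by exact_mod_cast hM
    refine ⟨(2 ^ L) ^ M, ?_, ?_⟩
    · rw [hnq, ← Real.rpow_sub (by norm_num)]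
      push_cast
      rw [← pow_mul, ← Real.rpow_natCast]
      apply Real.rpow_le_rpow_of_exponent_le two1.le
      push_cast
      have hM2 : (M : ℝ) = L - 86 := by linarith
      rw [hM2]
      nlinarith
    · apply crossing_of_large L M (by omega) P hP
      have hexp : 5 * (16 * L + 4) + (4 + L) * M ≤ (L - 1) * (L - 1) := by
        have : L - 1 = 85 + M := by omega
        rw [this, hM]; ring_nf; omega
      have hlow : 2 ^ ((L - 1) * (L - 1)) ≤ n := by
        have : ((2 ^ ((L - 1) * (L - 1)) : ℕ) : ℝ) ≤ n := by
          rw [hnq]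
          push_cast
          rw [← Real.rpow_natCast]
          apply Real.rpow_le_rpow_of_exponent_le two1.le
          rw [Nat.cast_mul, Nat.cast_sub (by omega)]
          push_cast
          have : (0 : ℝ) ≤ L - 1 := by rw [hMr]; have := Nat.cast_nonneg (α := ℝ) M; linarith
          exact mul_le_mul (by linarith) (by linarith) this (by linarith)
        exact_mod_cast this
      calc 18 ^ (16 * L + 4) * (16 * 2 ^ L) ^ M
          ≤ (2 ^ 5) ^ (16 * L + 4) * (2 ^ 4 * 2 ^ L) ^ M := by
            apply Nat.mul_le_mul
            · exact Nat.pow_le_pow_left (by norm_num) _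
            · norm_num
        _ = 2 ^ (5 * (16 * L + 4) + (4 + L) * M) := by
            rw [← pow_mul, ← pow_add 2 4 L, ← pow_mul, ← pow_add]
        _ ≤ 2 ^ ((L - 1) * (L - 1)) := Nat.pow_le_pow_right (by norm_num) hexp
        _ ≤ n := hlow
end

section
/- For every odd integer k ≥ 3, there exists a set P of 3k − 1 points in the plane in general position such that P contains a spoke set of size ⌊3k/2⌋, yet every crossing family in P has size at most k. -/
open scoped Classical

namespace Spoke

def cls (h j : ℕ) : ℕ := if j < h then 0 else if j < 2 * h then 1 else 2

abbrev Ix (h : ℕ) := Fin (3 * h + 1) × Bool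

def sd (b : Bool) : ℕ := if b then 1 else 0

def qq {h : ℕ} (i : Ix h) : ℕ := 2 * cls h i.1 + sd i.2

def rk {h : ℕ} (i : Ix h) : ℕ := qq i * (3 * h + 1) + i.1

def sl {h : ℕ} (i : Ix h) : ℤ := 3 * (i.1 : ℕ) - 2 + sd i.2

def ep {h : ℕ} (i : Ix h) : ℤ := if i.2 then -1 else 1

def br {h : ℕ} (i j : Ix h) : ℤ := ep i * ep j * (sl j - sl i)

noncomputable def mg {h : ℕ} (i : Ix h) : ℝ := ((18 * h + 7 : ℕ) : ℝ) ^ rk i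

noncomputable def ab {h : ℕ} (i : Ix h) : ℝ := ep i * mg i

noncomputable def pt {h : ℕ} (i : Ix h) : Pt := (ab i, ab i * sl i)

def dt (p q r : Pt) : ℝ := (q.1 - p.1) * (r.2 - p.2) - (q.2 - p.2) * (r.1 - p.1)

lemma ep_sq {h : ℕ} (i : Ix h) : ep i = 1 ∨ ep i = -1 := by
  unfold ep; split_ifs <;> simp

lemma mg_pos {h : ℕ} (i : Ix h) : 0 < mg i := by
  unfold mg; positivity

lemma sl_inj {h : ℕ} {i j : Ix h} (hs : sl i = sl j) : i = j := by
  rcases i with ⟨⟨a, ha⟩, s⟩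
  rcases j with ⟨⟨b, hb⟩, t⟩
  cases s <;> cases t <;> simp [sl, sd] at hs ⊢ <;> omega

lemma rk_inj {h : ℕ} {i j : Ix h} (hs : rk i = rk j) : i = j := by
  have h1 : qq i = qq j := by
    have := congrArg (· / (3 * h + 1)) hs
    simp only [rk] at this
    rw [add_comm, Nat.add_mul_div_right _ _ (by omega), add_comm (qq j * _),
      Nat.add_mul_div_right _ _ (by omega), Nat.div_eq_of_lt i.1.2, Nat.div_eq_of_lt j.1.2] at this
    omega
  have h2 : (i.1 : ℕ) = j.1 := by
    simp only [rk, h1] at hs; omega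
  have h3 : sd i.2 = sd j.2 := by
    simp only [qq, h2] at h1; omega
  rcases i with ⟨⟨a, ha⟩, s⟩
  rcases j with ⟨⟨b, hb⟩, t⟩
  cases s <;> cases t <;> simp_all [sd]

lemma qq_le {h : ℕ} {i j : Ix h} (hs : rk i < rk j) : qq i ≤ qq j := by
  by_contra hc
  push Not at hc
  have h1 : (qq j + 1) * (3 * h + 1) ≤ qq i * (3 * h + 1) := Nat.mul_le_mul_right _ hc
  have := j.1.2
  simp only [rk] at hs
  nlinarith

lemma mg_mul {h : ℕ} {i j : Ix h} (hs : rk i < rk j) :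
    ((18 * h + 7 : ℕ) : ℝ) * mg i ≤ mg j := by
  unfold mg
  rw [← pow_succ']
  exact pow_le_pow_right₀ (by exact_mod_cast (by omega)) hs

lemma sl_bd {h : ℕ} (i j : Ix h) : |((sl i : ℤ) : ℝ) - sl j| ≤ 9 * h + 3 := by
  have h1 : |sl i - sl j| ≤ 9 * h + 3 := by
    have := i.1.2
    have := j.1.2
    rw [abs_le]
    unfold sl sd
    split_ifs <;> constructor <;> push_cast <;> omega
  exact_mod_cast h1

lemma abs_ab {h : ℕ} (i : Ix h) : |ab i| = mg i := by
  unfold ab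
  rw [abs_mul, abs_of_pos (mg_pos i)]
  rcases ep_sq i with e | e <;> simp [e]

lemma dt_eq {h : ℕ} (i j k : Ix h) : dt (pt i) (pt j) (pt k) =
    ab i * ab j * (sl j - sl i) + ab j * ab k * (sl k - sl j) + ab k * ab i * (sl i - sl k) := by
  simp only [dt, pt]; ring

lemma br_ne {h : ℕ} {i j : Ix h} (hij : i ≠ j) : br i j ≠ 0 := by
  unfold br
  have : sl j - sl i ≠ 0 := fun hc => hij (sl_inj (by omega))
  rcases ep_sq i with e | e <;> rcases ep_sq j with e' | e' <;> simp only [e, e'] <;> omega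

lemma br_swap {h : ℕ} (i j : Ix h) : br j i = - br i j := by
  unfold br; ring

lemma key_sign {h : ℕ} {i j k : Ix h} (hij : rk i < rk j) (hjk : rk j < rk k) :
    0 < dt (pt i) (pt j) (pt k) * br j k := by
  have hne : j ≠ k := fun hc => by simp [hc] at hjk
  set D : ℝ := 9 * h + 3 with hD
  have hD0 : 0 < D := by positivity
  have hK : ((18 * h + 7 : ℕ) : ℝ) = 2 * D + 1 := by push_cast; rw [hD]; ring
  have m1 := mg_mul hij
  have m2 := mg_mul hjk
  rw [hK] at m1 m2
  have pi := mg_pos i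
  have pj := mg_pos j
  have pk := mg_pos k
  have e1 : |ab i * ab j * (sl j - sl i)| ≤ mg i * mg j * D := by
    rw [abs_mul, abs_mul, abs_ab, abs_ab]
    exact mul_le_mul_of_nonneg_left (sl_bd j i) (by positivity)
  have e2 : |ab k * ab i * (sl i - sl k)| ≤ mg k * mg i * D := by
    rw [abs_mul, abs_mul, abs_ab, abs_ab]
    exact mul_le_mul_of_nonneg_left (sl_bd i k) (by positivity)
  have hb : (ab j * ab k * (sl k - sl j) : ℝ) = mg j * mg k * br j k := by
    unfold ab br; push_cast; ring
  have hlt : mg i * mg j * D + mg k * mg i * D < mg j * mg k := by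
    have a1 : mg j ≤ mg k := by nlinarith
    have a2 : mg i * mg j ≤ mg i * mg k := mul_le_mul_of_nonneg_left a1 pi.le
    have a3 : (2 * D + 1) * mg i * mg k ≤ mg j * mg k := mul_le_mul_of_nonneg_right m1 pk.le
    have a4 : 0 < mg i * mg k := by positivity
    nlinarith
  have hs := abs_le.1 e1
  have ht := abs_le.1 e2
  rw [dt_eq, hb]
  have pjk : 0 < mg j * mg k := by positivity
  have hbr := br_ne hne
  rcases lt_or_gt_of_ne hbr with hn | hp
  · have : (br j k : ℝ) ≤ -1 := by exact_mod_cast (by omega : br j k ≤ -1)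
    apply mul_pos_of_neg_of_neg
    · nlinarith
    · linarith
  · have : (1 : ℝ) ≤ br j k := by exact_mod_cast (by omega : 1 ≤ br j k)
    apply mul_pos
    · nlinarith
    · linarith

lemma dt_rot (p q r : Pt) : dt q r p = dt p q r := by unfold dt; ring
lemma dt_swap (p q r : Pt) : dt q p r = - dt p q r := by unfold dt; ring

lemma dt_ne {h : ℕ} {i j k : Ix h} (hij : i ≠ j) (hik : i ≠ k) (hjk : j ≠ k) :
    dt (pt i) (pt j) (pt k) ≠ 0 := by
  have r1 : rk i ≠ rk j := fun hc => hij (rk_inj hc)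
  have r2 : rk i ≠ rk k := fun hc => hik (rk_inj hc)
  have r3 : rk j ≠ rk k := fun hc => hjk (rk_inj hc)
  intro hc
  have c1 := dt_rot (pt i) (pt j) (pt k)
  have c2 := dt_rot (pt j) (pt k) (pt i)
  have c3 := dt_swap (pt i) (pt j) (pt k)
  have c4 := dt_swap (pt j) (pt k) (pt i)
  have c5 := dt_swap (pt k) (pt i) (pt j)
  have key : ∀ a b c : Ix h, rk a < rk b → rk b < rk c → dt (pt a) (pt b) (pt c) = 0 → False := by
    intro a b c h1 h2 h3
    have := key_sign h1 h2
    simp [h3] at this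
  rcases lt_or_gt_of_ne r1 with a | a <;> rcases lt_or_gt_of_ne r2 with b | b <;>
    rcases lt_or_gt_of_ne r3 with c | c
  · exact key i j k a c hc
  · exact key i k j b c (by linarith)
  · omega
  · exact key k i j b a (by linarith)
  · exact key j i k a b (by linarith)
  · omega
  · exact key j k i c b (by linarith)
  · exact key k j i c a (by linarith)

lemma pt_inj {h : ℕ} : Function.Injective (pt (h := h)) := by
  intro i j hij
  have h1 : ab i = ab j := congrArg Prod.fst hij
  have h2 : ab i * sl i = ab j * sl j := congrArg Prod.snd hij
  have h3 : ab j ≠ 0 := by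
    intro hc
    have := abs_ab j
    rw [hc] at this
    have := mg_pos j
    simp at *
    linarith
  rw [h1] at h2
  exact sl_inj (by exact_mod_cast mul_left_cancel₀ h3 h2)

noncomputable def PP (h : ℕ) : Finset Pt := Finset.univ.image (pt (h := h))

lemma PP_card (h : ℕ) : (PP h).card = 6 * h + 2 := by
  unfold PP
  rw [Finset.card_image_of_injective _ pt_inj]
  simp [Fintype.card_prod]; ring

lemma dt_collinear {p q r : Pt} (hc : Collinear ℝ ({p, q, r} : Set Pt)) : dt p q r = 0 := by
  rw [collinear_iff_of_mem (p₀ := p) (by simp)] at hc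
  obtain ⟨v, hv⟩ := hc
  obtain ⟨a, ha⟩ := hv q (by simp)
  obtain ⟨b, hb⟩ := hv r (by simp)
  subst ha hb
  simp [dt]
  ring

lemma PP_gen (h : ℕ) : GenPos (PP h) := by
  intro p hp q hq r hr h1 h2 h3 hc
  simp only [PP, Finset.mem_image, Finset.mem_univ, true_and] at hp hq hr
  obtain ⟨i, rfl⟩ := hp
  obtain ⟨j, rfl⟩ := hq
  obtain ⟨k, rfl⟩ := hr
  exact dt_ne (fun e => h1 (by rw [e])) (fun e => h2 (by rw [e])) (fun e => h3 (by rw [e]))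
    (dt_collinear hc)

/-! ### Spokes -/

def ff (j : ℕ) (x : Pt) : ℝ := 3 * j * x.1 - x.2

def spl (j : ℕ) : Line := ⟨3 * j, -1, 0, Or.inr (by norm_num)⟩

lemma mem_spl (j : ℕ) (x : Pt) : x ∈ (spl j).toSet ↔ ff j x = 0 := by
  simp only [spl, Line.toSet, ff, Set.mem_ofPred_eq]
  constructor <;> intro h <;> linarith

lemma ff_pt {h : ℕ} (j : ℕ) (i : Ix h) : ff j (pt i) = mg i * ((ep i * (3 * j - sl i) : ℤ) : ℝ) := by
  simp only [ff, pt, ab]; push_cast; ring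

lemma ff_sign {h : ℕ} (x : Pt) (hx : ∀ j < 3 * h + 1, ff j x ≠ 0) :
    ∃ i : Ix h, ∀ j < 3 * h + 1, 0 < ff j x * ff j (pt i) := by
  have red : ∀ i : Ix h, (∀ j < 3 * h + 1, 0 < ff j x * ((ep i * (3 * j - sl i) : ℤ) : ℝ)) →
      ∀ j < 3 * h + 1, 0 < ff j x * ff j (pt i) := by
    intro i hi j hj
    rw [ff_pt]
    have := mul_pos (mg_pos i) (hi j hj)
    linarith
  have mono : ∀ j k : ℕ, j ≤ k → ff k x - ff j x = 3 * ((k : ℝ) - j) * x.1 := by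
    intro j k _; unfold ff; ring
  have pp : ∀ (j : ℕ) (z : ℤ), 0 < ff j x → 0 < z → 0 < ff j x * (z : ℝ) := fun j z a b =>
    mul_pos a (by exact_mod_cast b)
  have nn : ∀ (j : ℕ) (z : ℤ), ff j x < 0 → z < 0 → 0 < ff j x * (z : ℝ) := fun j z a b =>
    mul_pos_of_neg_of_neg a (by exact_mod_cast b)
  rcases le_total 0 x.1 with h0 | h0
  · by_cases hex : ∃ i, i < 3 * h + 1 ∧ 0 < ff i x
    · obtain ⟨hi, hpos⟩ := Nat.find_spec hex
      have hmin := fun m => Nat.find_min hex (m := m)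
      generalize Nat.find hex = i0 at hi hpos hmin
      refine ⟨(⟨i0, hi⟩, false), red _ ?_⟩
      intro j hj
      by_cases hji : j < i0
      · have := hmin j hji
        have hneg : ff j x < 0 := lt_of_le_of_ne (by push Not at this; exact this hj) (hx j hj)
        apply nn _ _ hneg
        simp [ep, sl, sd]; omega
      · push Not at hji
        have := mono _ _ hji
        have hc : (i0 : ℝ) ≤ j := by exact_mod_cast hji
        have : 0 ≤ 3 * ((j : ℝ) - i0) * x.1 := by
          apply mul_nonneg _ h0; linarith
        apply pp _ _ (by linarith)
        simp [ep, sl, sd]; omega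
    · push Not at hex
      refine ⟨(⟨0, by omega⟩, true), red _ ?_⟩
      intro j hj
      apply nn _ _ (lt_of_le_of_ne (hex j hj) (hx j hj))
      simp [ep, sl, sd]; omega
  · by_cases hex : ∃ i, i < 3 * h + 1 ∧ ff i x < 0
    · obtain ⟨hi, hpos⟩ := Nat.find_spec hex
      have hmin := fun m => Nat.find_min hex (m := m)
      generalize Nat.find hex = i0 at hi hpos hmin
      refine ⟨(⟨i0, hi⟩, true), red _ ?_⟩
      intro j hj
      by_cases hji : j < i0
      · have := hmin j hji
        have hneg : 0 < ff j x := lt_of_le_of_ne (by push Not at this; exact this hj) (hx j hj).symm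
        apply pp _ _ hneg
        simp [ep, sl, sd]; omega
      · push Not at hji
        have := mono _ _ hji
        have hc : (i0 : ℝ) ≤ j := by exact_mod_cast hji
        have : 3 * ((j : ℝ) - i0) * x.1 ≤ 0 := by
          apply mul_nonpos_of_nonneg_of_nonpos _ h0; linarith
        apply nn _ _ (by linarith)
        simp [ep, sl, sd]; omega
    · push Not at hex
      refine ⟨(⟨0, by omega⟩, false), red _ ?_⟩
      intro j hj
      apply pp _ _ (lt_of_le_of_ne (hex j hj) (hx j hj).symm)
      simp [ep, sl, sd]; omega

lemma PP_spoke (h : ℕ) : SpokeSet (PP h) (3 * h + 1) := by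
  refine ⟨fun j => spl j, ?_, ?_⟩
  · intro i j hij hp
    apply hij
    simp only [Line.Parallel, spl] at hp
    have : ((i : ℕ) : ℝ) = (j : ℕ) := by linarith
    exact Fin.ext (by exact_mod_cast this)
  · intro x hx _
    have hx' : ∀ j < 3 * h + 1, ff j x ≠ 0 := by
      intro j hj hc
      apply hx
      rw [Set.mem_iUnion]
      exact ⟨⟨j, hj⟩, (mem_spl j x).2 hc⟩
    obtain ⟨i, hi⟩ := ff_sign x hx'
    refine ⟨pt i, Finset.mem_image_of_mem _ (Finset.mem_univ _), ?_⟩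
    let S : Set Pt := {z | ∀ j < 3 * h + 1, 0 < ff j x * ff j z}
    have hconv : Convex ℝ S := by
      intro y hy z hz a b ha hb hab j hj
      have e : ff j x * ff j (a • y + b • z) = a * (ff j x * ff j y) + b * (ff j x * ff j z) := by
        simp [ff]; ring
      rw [e]
      have h1 := hy j hj
      have h2 := hz j hj
      rcases ha.lt_or_eq with h3 | h3
      · have := mul_pos h3 h1
        have := mul_nonneg hb h2.le
        linarith
      · have : b = 1 := by linarith
        rw [← h3, this]; linarith
    have hxS : x ∈ S := fun j hj => mul_self_pos.2 (hx' j hj)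
    have hsub : S ⊆ (⋃ j : Fin (3 * h + 1), (spl j).toSet)ᶜ := by
      intro z hz hc
      rw [Set.mem_iUnion] at hc
      obtain ⟨j, hj⟩ := hc
      have := hz j j.2
      rw [(mem_spl j z).1 hj] at this
      simp at this
    exact hconv.isPreconnected.subset_connectedComponentIn hxS hsub hi

/-! ### Crossing -/

lemma cross_dt {p q r s : Pt} (hc : SegCross (p, q) (r, s)) :
    ∃ t : ℝ, 0 < t ∧ t < 1 ∧ (1 - t) * dt p q r + t * dt p q s = 0 := by
  obtain ⟨x, -, h1, h2⟩ := hc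
  obtain ⟨a, b, ha, hb, hab, h1⟩ := h1
  obtain ⟨c, d, hc, hd, hcd, h2⟩ := h2
  refine ⟨d, hd, by linarith, ?_⟩
  have ea : a = 1 - b := by linarith
  have ec : c = 1 - d := by linarith
  have e1 : x.1 = (1 - b) * p.1 + b * q.1 := by rw [← h1, ea]; simp
  have e2 : x.2 = (1 - b) * p.2 + b * q.2 := by rw [← h1, ea]; simp
  have e3 : x.1 = (1 - d) * r.1 + d * s.1 := by rw [← h2, ec]; simp
  have e4 : x.2 = (1 - d) * r.2 + d * s.2 := by rw [← h2, ec]; simp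
  have k1 : (1 - d) * dt p q r + d * dt p q s = dt p q x := by
    simp only [dt]; rw [e3, e4]; ring
  rw [k1]; simp only [dt]; rw [e1, e2]; ring

lemma _root_.SegCross.symm'_s5 {e f : Pt × Pt} (hc : SegCross e f) : SegCross f e := by
  obtain ⟨x, h0, h1, h2⟩ := hc
  exact ⟨x, by rw [Set.inter_comm]; exact h0, h2, h1⟩

lemma _root_.SegCross.swap1 {p q : Pt} {f : Pt × Pt} (hc : SegCross (p, q) f) : SegCross (q, p) f := by
  obtain ⟨x, h0, h1, h2⟩ := hc
  exact ⟨x, by simpa [segment_symm ℝ q p] using h0, by simpa [openSegment_symm ℝ q p] using h1, h2⟩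

lemma no_share {h : ℕ} {a b d : Ix h} (hc : SegCross (pt a, pt b) (pt a, pt d)) : b = d := by
  by_contra hbd
  by_cases hab : a = b
  · subst hab
    obtain ⟨x, -, h1, h2⟩ := hc
    simp only [openSegment_same, Set.mem_singleton_iff] at h1
    subst h1
    rw [left_mem_openSegment_iff] at h2
    exact hbd (pt_inj h2)
  by_cases had : a = d
  · subst had
    obtain ⟨x, -, h1, h2⟩ := hc
    simp only [openSegment_same, Set.mem_singleton_iff] at h2
    subst h2
    rw [left_mem_openSegment_iff] at h1
    exact hab (pt_inj h1)
  obtain ⟨t, h0, h1, h2⟩ := cross_dt hc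
  have h3 : dt (pt a) (pt b) (pt a) = 0 := by unfold dt; ring
  rw [h3] at h2
  have := dt_ne hab had hbd
  have : t * dt (pt a) (pt b) (pt d) ≠ 0 := mul_ne_zero h0.ne' this
  apply this; linarith

lemma deg_left {h : ℕ} {a c d : Ix h} (hc : SegCross (pt a, pt a) (pt c, pt d))
    (hac : a ≠ c) (had : a ≠ d) : False := by
  by_cases hcd : c = d
  · subst hcd
    obtain ⟨x, -, h1, h2⟩ := hc
    simp only [openSegment_same, Set.mem_singleton_iff] at h1 h2
    exact hac (pt_inj (h1.symm.trans h2))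
  · obtain ⟨t, h0, h1, h2⟩ := cross_dt hc.symm'_s5
    have := dt_ne hcd hac.symm had.symm
    apply this; linarith

lemma no_flip {h : ℕ} {a b : Ix h} (hc : SegCross (pt a, pt b) (pt b, pt a)) : a = b := by
  obtain ⟨x, h0, -, -⟩ := hc
  simp only [segment_symm ℝ (pt b) (pt a), Set.inter_self] at h0
  have h1 : pt a ∈ segment ℝ (pt a) (pt b) := left_mem_segment ℝ _ _
  have h2 : pt b ∈ segment ℝ (pt a) (pt b) := right_mem_segment ℝ _ _
  rw [h0, Set.mem_singleton_iff] at h1 h2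
  exact pt_inj (h1.trans h2.symm)

lemma swap2 {p q r s : Pt} (hc : SegCross (p, q) (r, s)) : SegCross (p, q) (s, r) :=
  hc.symm'_s5.swap1.symm'_s5

lemma distinct4 {h : ℕ} {a b c d : Ix h} (hc : SegCross (pt a, pt b) (pt c, pt d))
    (hne : (a, b) ≠ (c, d)) : a ≠ b ∧ c ≠ d ∧ a ≠ c ∧ a ≠ d ∧ b ≠ c ∧ b ≠ d := by
  have h1 : a ≠ c := by
    rintro rfl
    have := no_share hc
    subst this; exact hne rfl
  have h2 : b ≠ d := by
    rintro rfl
    have := no_share (swap2 hc.swap1)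
    subst this; exact hne rfl
  have h3 : a ≠ d := by
    rintro rfl
    have := no_share (swap2 hc)
    subst this
    exact h1 (no_flip hc)
  have h4 : b ≠ c := by
    rintro rfl
    have := no_share hc.swap1
    exact h3 this
  refine ⟨?_, ?_, h1, h3, h4, h2⟩
  · rintro rfl; exact deg_left hc h1 h3
  · rintro rfl; exact deg_left hc.symm'_s5 h1.symm h4.symm

lemma cross_strict {h : ℕ} {a b c d : Ix h} (hc : SegCross (pt a, pt b) (pt c, pt d))
    (hab : a ≠ b) (hac : a ≠ c) (hbc : b ≠ c) :
    dt (pt a) (pt b) (pt c) * dt (pt a) (pt b) (pt d) < 0 := by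
  obtain ⟨t, h0, h1, h2⟩ := cross_dt hc
  have hA := dt_ne hab hac hbc
  set A := dt (pt a) (pt b) (pt c)
  set B := dt (pt a) (pt b) (pt d)
  have hA2 : 0 < A * A := mul_self_pos.2 hA
  have : t * (A * B) = - ((1 - t) * (A * A)) := by linear_combination A * h2
  by_contra hcon
  push Not at hcon
  have := mul_nonneg h0.le hcon
  have : 0 < (1 - t) * (A * A) := mul_pos (by linarith) hA2
  linarith

/-- The combinatorial part of one crossing pattern. -/
def half {h : ℕ} (a b c d : Ix h) : Prop :=
  rk c < rk a ∧ (rk b < rk d ∨ (rk a < rk d ∧ rk d < rk b)) ∧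
    0 < br a b * br a d ∧ 0 < br a b * br d b

lemma sgn_aux {A B : ℝ} {x y : ℤ} (hA : 0 < A * x) (hB : 0 < B * y) (h : A * B < 0) :
    x * y < 0 := by
  have h1 : 0 < (A * x) * (B * y) := mul_pos hA hB
  have h2 : ((x * y : ℤ) : ℝ) < 0 := by
    by_contra hc
    push Not at hc
    push_cast at hc
    nlinarith
  exact_mod_cast h2

lemma half_of_cross {h : ℕ} {a b c d : Ix h} (hc : SegCross (pt a, pt b) (pt c, pt d))
    (hne : (a, b) ≠ (c, d)) (hab : rk a < rk b) (hcd : rk c < rk d) (hbd : rk b < rk d) :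
    half a b c d ∨ half c d a b := by
  obtain ⟨n1, n2, n3, n4, n5, n6⟩ := distinct4 hc hne
  have s1 := cross_strict hc n1 n3 n5
  have s2 := cross_strict hc.symm'_s5 n2 n3.symm n4.symm
  have r1 : rk a ≠ rk c := fun e => n3 (rk_inj e)
  have r2 : rk b ≠ rk c := fun e => n5 (rk_inj e)
  rcases lt_or_gt_of_ne r1 with hac | hca
  · rcases lt_or_gt_of_ne r2 with hbc | hcb
    · exfalso
      have k1 := key_sign (hab.trans hbc) hcd
      have k2 := key_sign hbc hcd
      rw [← dt_rot] at k1 k2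
      have := sgn_aux k1 k2 s2
      nlinarith [mul_self_nonneg (br c d)]
    · right
      have k1 := key_sign hac hcb
      have k2 := key_sign hab hbd
      have k3 := key_sign hac hcd
      have k4 := key_sign hcb hbd
      have e1 : dt (pt a) (pt c) (pt b) = - dt (pt a) (pt b) (pt c) := by unfold dt; ring
      have e3 : dt (pt a) (pt c) (pt d) = dt (pt c) (pt d) (pt a) := by unfold dt; ring
      have e4 : dt (pt c) (pt b) (pt d) = - dt (pt c) (pt d) (pt b) := by unfold dt; ring
      rw [e1] at k1
      rw [e3] at k3
      rw [e4] at k4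
      have p1 := sgn_aux (A := dt (pt a) (pt b) (pt c)) (x := - br c b) (by push_cast; linarith) k2 s1
      have p2 := sgn_aux (B := dt (pt c) (pt d) (pt b)) (y := - br b d) k3 (by push_cast; linarith) s2
      have p2' : 0 < br c d * br b d := by linarith
      refine ⟨hac, Or.inr ⟨hcb, hbd⟩, ?_, p2'⟩
      have p1' : 0 < br c b * br b d := by linarith
      have := mul_pos p1' p2'
      have sq : 0 < br b d * br b d := mul_self_pos.2 (br_ne n6)
      by_contra hcon
      push Not at hcon
      nlinarith
  · left
    have k1 := key_sign hca hab
    have k2 := key_sign hab hbd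
    have k3 := key_sign hca (hab.trans hbd)
    have k4 := key_sign (hca.trans hab) hbd
    have e1 : dt (pt c) (pt a) (pt b) = dt (pt a) (pt b) (pt c) := by unfold dt; ring
    have e3 : dt (pt c) (pt a) (pt d) = - dt (pt c) (pt d) (pt a) := by unfold dt; ring
    have e4 : dt (pt c) (pt b) (pt d) = - dt (pt c) (pt d) (pt b) := by unfold dt; ring
    rw [e1] at k1
    rw [e3] at k3
    rw [e4] at k4
    have p1 := sgn_aux k1 k2 s1
    have p2 := sgn_aux (A := dt (pt c) (pt d) (pt a)) (x := - br a d)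
      (B := dt (pt c) (pt d) (pt b)) (y := - br b d) (by push_cast; linarith)
      (by push_cast; linarith) s2
    have p3 : 0 < br a b * br d b := by rw [br_swap b d]; linarith
    refine ⟨hca, Or.inl hbd, ?_, p3⟩
    have p4 : br a d * br b d < 0 := by linarith
    have := mul_pos_of_neg_of_neg p1 p4
    have sq : 0 < br b d * br b d := mul_self_pos.2 (br_ne n6)
    by_contra hcon
    push Not at hcon
    nlinarith

/-! ### Types of edges -/

abbrev Ty := ℕ × ℕ × Bool

def mp (u v : ℕ) (s : Bool) : Bool :=
  (u / 2 == v / 2) || (s == (Nat.blt (u / 2) (v / 2) == (u % 2 == v % 2)))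

def hb (t t' : Ty) : Bool :=
  Nat.ble t'.1 t.1 && (Nat.ble t.2.1 t'.2.1 || (Nat.ble t.1 t'.2.1 && Nat.ble t'.2.1 t.2.1)) &&
    mp t.1 t'.2.1 t.2.2 && mp t'.2.1 t.2.1 t.2.2

def cp (t t' : Ty) : Bool := t == t' || hb t t' || hb t' t

def allTy : List Ty :=
  ((List.range 6).flatMap fun u => (List.range 6).flatMap fun v =>
    [(u, v, true), (u, v, false)]).filter fun t => Nat.ble t.1 t.2.1 && mp t.1 t.2.1 t.2.2

def wt (l : List ℕ) (q : ℕ) : ℕ := l.getD q 0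

def W1 : List ℕ := [0, 0, 2, 0, 2, 0]
def W2 : List ℕ := [0, 0, 0, 2, 0, 2]
def W3 : List ℕ := [2, 2, 0, 0, 0, 0]
def W4 : List ℕ := [1, 0, 0, 0, 1, 2]
def W5 : List ℕ := [1, 1, 1, 1, 0, 0]

def vio (l : List ℕ) : List Ty := allTy.filter fun t => Nat.blt (wt l t.1 + wt l t.2.1) 2

def checkAll : Bool :=
  (vio W3).all fun t1 => (vio W1).all fun t2 => !cp t1 t2 ||
    (vio W2).all fun t3 => !cp t1 t3 || !cp t2 t3 ||
      (vio W5).all fun t4 => !cp t1 t4 || !cp t2 t4 || !cp t3 t4 ||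
        (vio W4).all fun t5 => !cp t1 t5 || !cp t2 t5 || !cp t3 t5 || !cp t4 t5

lemma checkAll_true : checkAll = true := by decide +kernel

lemma no_transversal (t1 t2 t3 t4 t5 : Ty) (h1 : t1 ∈ vio W3) (h2 : t2 ∈ vio W1)
    (h3 : t3 ∈ vio W2) (h4 : t4 ∈ vio W5) (h5 : t5 ∈ vio W4)
    (c12 : cp t1 t2 = true) (c13 : cp t1 t3 = true) (c23 : cp t2 t3 = true)
    (c14 : cp t1 t4 = true) (c24 : cp t2 t4 = true) (c34 : cp t3 t4 = true)
    (c15 : cp t1 t5 = true) (c25 : cp t2 t5 = true) (c35 : cp t3 t5 = true)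
    (c45 : cp t4 t5 = true) : False := by
  have H := checkAll_true
  unfold checkAll at H
  have H1 := List.all_eq_true.1 (List.all_eq_true.1 H t1 h1) t2 h2
  rw [c12] at H1
  have H2 := List.all_eq_true.1 (by simpa only [Bool.not_true, Bool.false_or] using H1) t3 h3
  rw [c13, c23] at H2
  have H3 := List.all_eq_true.1 (by simpa only [Bool.not_true, Bool.false_or] using H2) t4 h4
  rw [c14, c24, c34] at H3
  have H4 := List.all_eq_true.1 (by simpa only [Bool.not_true, Bool.false_or] using H3) t5 h5
  rw [c15, c25, c35, c45] at H4
  simp at H4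

lemma cls_lt (h j : ℕ) : cls h j < 3 := by unfold cls; split_ifs <;> omega

lemma qq_lt {h : ℕ} (i : Ix h) : qq i < 6 := by
  have := cls_lt h i.1
  unfold qq sd; split_ifs <;> omega

lemma cls_mono {h a b : ℕ} (hab : cls h a < cls h b) : a < b := by
  unfold cls at hab; split_ifs at hab <;> omega

lemma qq_div {h : ℕ} (i : Ix h) : qq i / 2 = cls h i.1 := by
  unfold qq sd; split_ifs <;> omega

lemma qq_mod {h : ℕ} (i : Ix h) : qq i % 2 = sd i.2 := by
  unfold qq sd; split_ifs <;> omega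

lemma mp_br {h : ℕ} (i j : Ix h) : mp (qq i) (qq j) (decide (0 < br i j)) = true := by
  unfold mp
  rw [qq_div, qq_div, qq_mod, qq_mod]
  by_cases he : cls h i.1 = cls h j.1
  · simp [he]
  · have hx : (i.1 : ℕ) < j.1 ∧ cls h i.1 < cls h j.1 ∨
        (j.1 : ℕ) < i.1 ∧ ¬ cls h i.1 < cls h j.1 := by
      rcases lt_or_gt_of_ne he with hl | hl
      · exact Or.inl ⟨cls_mono hl, hl⟩
      · exact Or.inr ⟨cls_mono hl, by omega⟩
    have hblt : Nat.blt (cls h i.1) (cls h j.1) = decide (cls h i.1 < cls h j.1) := by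
      rw [Bool.eq_iff_iff]; simp
    rw [hblt]
    rcases i with ⟨i, s⟩
    rcases j with ⟨j, t⟩
    rcases hx with ⟨h1, h2⟩ | ⟨h1, h2⟩ <;> dsimp only at h1 h2 <;> cases s <;> cases t <;>
      simp [br, ep, sl, sd, h2] <;> omega

def ty {h : ℕ} (e : Ix h × Ix h) : Ty := (qq e.1, qq e.2, decide (0 < br e.1 e.2))

lemma mp_of {h : ℕ} {x : ℤ} (i j : Ix h) (hx : 0 < x * br i j) :
    mp (qq i) (qq j) (decide (0 < x)) = true := by
  have : decide (0 < x) = decide (0 < br i j) := by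
    rw [decide_eq_decide]
    constructor
    · intro hp; exact (pos_iff_pos_of_mul_pos hx).1 hp
    · intro hp; exact (pos_iff_pos_of_mul_pos hx).2 hp
  rw [this]; exact mp_br i j

lemma hb_of_half {h : ℕ} {a b c d : Ix h} (hh : half a b c d) : hb (ty (a, b)) (ty (c, d)) = true := by
  obtain ⟨h1, h2, h3, h4⟩ := hh
  have m1 := mp_of a d h3
  have m2 := mp_of d b h4
  have q1 := qq_le h1
  simp only [hb, ty, m1, m2, Bool.and_true, Bool.and_eq_true, Bool.or_eq_true, Nat.ble_eq]
  refine ⟨q1, ?_⟩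
  rcases h2 with h2 | ⟨h2, h2'⟩
  · exact Or.inl (qq_le h2)
  · exact Or.inr ⟨qq_le h2, qq_le h2'⟩

lemma cp_of_cross {h : ℕ} {e f : Ix h × Ix h} (he : rk e.1 < rk e.2) (hf : rk f.1 < rk f.2)
    (hc : e ≠ f → SegCross (pt e.1, pt e.2) (pt f.1, pt f.2)) : cp (ty e) (ty f) = true := by
  by_cases hef : e = f
  · subst hef; simp [cp]
  have hc := hc hef
  rcases e with ⟨a, b⟩
  rcases f with ⟨c, d⟩
  have hd := distinct4 hc hef
  have hbd : rk b ≠ rk d := fun h => hd.2.2.2.2.2 (rk_inj h)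
  have key : half a b c d ∨ half c d a b := by
    rcases lt_or_gt_of_ne hbd with hl | hl
    · exact half_of_cross hc hef he hf hl
    · exact (half_of_cross hc.symm'_s5 (Ne.symm hef) hf he hl).symm
  rcases key with k | k
  · simp [cp, hb_of_half k]
  · simp [cp, hb_of_half k]

lemma ty_mem {h : ℕ} {e : Ix h × Ix h} (he : rk e.1 < rk e.2) : ty e ∈ allTy := by
  unfold allTy
  rw [List.mem_filter]
  constructor
  · simp only [List.mem_flatMap, List.mem_range]
    refine ⟨qq e.1, qq_lt _, qq e.2, qq_lt _, ?_⟩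
    unfold ty
    cases decide (0 < br e.1 e.2) <;> simp
  · simp [ty, qq_le he, mp_br]

lemma vio_mem {h : ℕ} {e : Ix h × Ix h} (he : rk e.1 < rk e.2) (l : List ℕ)
    (hv : wt l (qq e.1) + wt l (qq e.2) < 2) : ty e ∈ vio l := by
  unfold vio
  rw [List.mem_filter]
  refine ⟨ty_mem he, ?_⟩
  simpa [ty] using hv

/-! ### Counting -/

lemma sum_cls (h : ℕ) (g : ℕ → ℕ) :
    ∑ j : Fin (3 * h + 1), g (cls h j) = h * g 0 + h * g 1 + (h + 1) * g 2 := by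
  rw [Fin.sum_univ_eq_sum_range (fun j => g (cls h j)) (3 * h + 1)]
  have e : 3 * h + 1 = h + h + (h + 1) := by ring
  rw [e, Finset.sum_range_add, Finset.sum_range_add]
  have a1 : ∑ x ∈ Finset.range h, g (cls h x) = ∑ x ∈ Finset.range h, g 0 := by
    apply Finset.sum_congr rfl
    intro x hx
    simp at hx; simp [cls, hx]
  have a2 : ∑ x ∈ Finset.range h, g (cls h (h + x)) = ∑ x ∈ Finset.range h, g 1 := by
    apply Finset.sum_congr rfl
    intro x hx
    simp at hx
    have : h + x < 2 * h := by omega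
    simp [cls, this]
  have a3 : ∑ x ∈ Finset.range (h + 1), g (cls h (h + h + x)) =
      ∑ x ∈ Finset.range (h + 1), g 2 := by
    apply Finset.sum_congr rfl
    intro x hx
    have : ¬ h + h + x < h := by omega
    have h2 : ¬ h + h + x < 2 * h := by omega
    simp [cls, this, h2]
  rw [a1, a2, a3]; simp

lemma sum_wt (h : ℕ) (l : List ℕ) : ∑ i : Ix h, wt l (qq i) =
    h * (wt l 0 + wt l 1) + h * (wt l 2 + wt l 3) + (h + 1) * (wt l 4 + wt l 5) := by
  rw [Fintype.sum_prod_type]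
  have := sum_cls h (fun c => wt l (2 * c) + wt l (2 * c + 1))
  simp only [Fintype.sum_bool, qq, sd]
  simp at this ⊢
  rw [← this]
  apply Finset.sum_congr rfl
  intro x _; ring

lemma count_bound {h : ℕ} (G : Finset (Ix h × Ix h)) (w : Ix h → ℕ)
    (hd : ∀ e ∈ G, ∀ f ∈ G, e ≠ f → e.1 ≠ f.1 ∧ e.1 ≠ f.2 ∧ e.2 ≠ f.1 ∧ e.2 ≠ f.2)
    (hs : ∀ e ∈ G, e.1 ≠ e.2)
    (hw : ∀ e ∈ G, 2 ≤ w e.1 + w e.2) : 2 * G.card ≤ ∑ i, w i := by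
  have i1 : Set.InjOn (Prod.fst : Ix h × Ix h → Ix h) G := by
    intro e he f hf hef
    by_contra hc
    exact (hd e he f hf hc).1 hef
  have i2 : Set.InjOn (Prod.snd : Ix h × Ix h → Ix h) G := by
    intro e he f hf hef
    by_contra hc
    exact (hd e he f hf hc).2.2.2 hef
  have dj : Disjoint (G.image Prod.fst) (G.image Prod.snd) := by
    rw [Finset.disjoint_left]
    intro a ha hb
    rw [Finset.mem_image] at ha hb
    obtain ⟨e, he, rfl⟩ := ha
    obtain ⟨f, hf, hef⟩ := hb
    by_cases hc : e = f
    · subst hc; exact hs e he hef.symm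
    · exact (hd e he f hf hc).2.1 hef.symm
  calc 2 * G.card = ∑ e ∈ G, 2 := by simp [mul_comm]
    _ ≤ ∑ e ∈ G, (w e.1 + w e.2) := Finset.sum_le_sum hw
    _ = ∑ e ∈ G, w e.1 + ∑ e ∈ G, w e.2 := Finset.sum_add_distrib
    _ = ∑ i ∈ G.image Prod.fst, w i + ∑ i ∈ G.image Prod.snd, w i := by
        rw [Finset.sum_image i1, Finset.sum_image i2]
    _ = ∑ i ∈ G.image Prod.fst ∪ G.image Prod.snd, w i := (Finset.sum_union dj).symm
    _ ≤ ∑ i, w i := Finset.sum_le_sum_of_subset (Finset.subset_univ _)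

lemma bound_sorted {h : ℕ} (G : Finset (Ix h × Ix h)) (hr : ∀ e ∈ G, rk e.1 < rk e.2)
    (hG : ∀ e ∈ G, ∀ f ∈ G, e ≠ f → SegCross (pt e.1, pt e.2) (pt f.1, pt f.2)) :
    G.card ≤ 2 * h + 1 := by
  have hd : ∀ e ∈ G, ∀ f ∈ G, e ≠ f → e.1 ≠ f.1 ∧ e.1 ≠ f.2 ∧ e.2 ≠ f.1 ∧ e.2 ≠ f.2 := by
    intro e he f hf hef
    exact (distinct4 (hG e he f hf hef) hef).2.2
  have hs : ∀ e ∈ G, e.1 ≠ e.2 := by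
    intro e he hc
    have := hr e he
    rw [hc] at this
    exact lt_irrefl _ this
  by_contra hcon
  push Not at hcon
  have ex : ∀ l : List ℕ, h * (wt l 0 + wt l 1) + h * (wt l 2 + wt l 3) +
      (h + 1) * (wt l 4 + wt l 5) ≤ 4 * h + 3 →
      ∃ e ∈ G, ty e ∈ vio l := by
    intro l hl
    by_contra hno
    push Not at hno
    have := count_bound G (fun i => wt l (qq i)) hd hs (by
      intro e he
      by_contra hlt
      push Not at hlt
      exact hno e he (vio_mem (hr e he) l hlt))
    rw [sum_wt] at this
    omega
  obtain ⟨e1, g1, v1⟩ := ex W3 (by simp [wt, W3]; omega)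
  obtain ⟨e2, g2, v2⟩ := ex W1 (by simp [wt, W1]; omega)
  obtain ⟨e3, g3, v3⟩ := ex W2 (by simp [wt, W2]; omega)
  obtain ⟨e4, g4, v4⟩ := ex W5 (by simp [wt, W5]; omega)
  obtain ⟨e5, g5, v5⟩ := ex W4 (by simp [wt, W4]; omega)
  have C : ∀ e ∈ G, ∀ f ∈ G, cp (ty e) (ty f) = true := fun e he f hf =>
    cp_of_cross (hr e he) (hr f hf) (hG e he f hf)
  exact no_transversal _ _ _ _ _ v1 v2 v3 v4 v5 (C _ g1 _ g2) (C _ g1 _ g3) (C _ g2 _ g3)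
    (C _ g1 _ g4) (C _ g2 _ g4) (C _ g3 _ g4) (C _ g1 _ g5) (C _ g2 _ g5) (C _ g3 _ g5)
    (C _ g4 _ g5)

def srt {h : ℕ} (e : Ix h × Ix h) : Ix h × Ix h := if rk e.1 < rk e.2 then e else (e.2, e.1)

lemma srt_cross {h : ℕ} {e f : Ix h × Ix h}
    (hc : SegCross (pt e.1, pt e.2) (pt f.1, pt f.2)) :
    SegCross (pt (srt e).1, pt (srt e).2) (pt (srt f).1, pt (srt f).2) := by
  unfold srt
  split_ifs
  · exact hc
  · exact swap2 hc
  · exact hc.swap1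
  · exact swap2 hc.swap1

lemma srt_rk {h : ℕ} {e : Ix h × Ix h} (he : e.1 ≠ e.2) : rk (srt e).1 < rk (srt e).2 := by
  have : rk e.1 ≠ rk e.2 := fun hc => he (rk_inj hc)
  unfold srt
  split_ifs with h1
  · exact h1
  · simp only; omega

lemma srt_fst {h : ℕ} (e : Ix h × Ix h) : (srt e).1 = e.1 ∨ (srt e).1 = e.2 := by
  unfold srt; split_ifs <;> simp

lemma bound_ix {h : ℕ} (G : Finset (Ix h × Ix h))
    (hG : ∀ e ∈ G, ∀ f ∈ G, e ≠ f → SegCross (pt e.1, pt e.2) (pt f.1, pt f.2)) :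
    G.card ≤ 2 * h + 1 := by
  rcases Nat.lt_or_ge 1 G.card with h1 | h1
  swap
  · omega
  have hs : ∀ e ∈ G, e.1 ≠ e.2 := by
    intro e he
    obtain ⟨f, hf, hfe⟩ := Finset.exists_mem_ne h1 e
    exact (distinct4 (hG e he f hf hfe.symm) hfe.symm).1
  have inj : Set.InjOn (srt (h := h)) G := by
    intro e he f hf hef
    by_contra hc
    have hd := (distinct4 (hG e he f hf hc) hc).2.2
    rcases srt_fst e with a | a <;> rcases srt_fst f with b | b <;> rw [hef, b] at a
    · exact hd.1 a.symm
    · exact hd.2.1 a.symm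
    · exact hd.2.2.1 a.symm
    · exact hd.2.2.2 a.symm
  rw [← Finset.card_image_of_injOn inj]
  apply bound_sorted
  · intro e he
    rw [Finset.mem_image] at he
    obtain ⟨e, he, rfl⟩ := he
    exact srt_rk (hs e he)
  · intro e he f hf hef
    rw [Finset.mem_image] at he hf
    obtain ⟨e, he, rfl⟩ := he
    obtain ⟨f, hf, rfl⟩ := hf
    exact srt_cross (hG e he f hf (fun hc => hef (by rw [hc])))

lemma bound_main {h : ℕ} (F : Finset (Pt × Pt)) (hP : ∀ e ∈ F, e.1 ∈ PP h ∧ e.2 ∈ PP h)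
    (hF : ∀ e ∈ F, ∀ f ∈ F, e ≠ f → SegCross e f) : F.card ≤ 2 * h + 1 := by
  have hsub : F ⊆ Finset.univ.image (Prod.map (pt (h := h)) (pt (h := h))) := by
    intro e he
    obtain ⟨h1, h2⟩ := hP e he
    simp only [PP, Finset.mem_image, Finset.mem_univ, true_and] at h1 h2 ⊢
    obtain ⟨i, hi⟩ := h1
    obtain ⟨j, hj⟩ := h2
    exact ⟨(i, j), by rw [Prod.map_apply, hi, hj]⟩
  obtain ⟨G, -, rfl⟩ := Finset.subset_image_iff.1 hsub
  have hinj : Function.Injective (Prod.map (pt (h := h)) (pt (h := h))) := pt_inj.prodMap pt_inj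
  rw [Finset.card_image_of_injective _ hinj]
  apply bound_ix
  intro e he f hf hef
  exact hF _ (Finset.mem_image_of_mem _ he) _ (Finset.mem_image_of_mem _ hf)
    (fun hc => hef (hinj hc))

end Spoke

/-- For every odd integer `k ≥ 3`, there is a set `P` of `3k − 1` points in
general position containing a spoke set of size `⌊3k/2⌋`, such that every crossing family
in `P` has size at most `k`. -/
theorem stmt5 :
    ∀ k : ℕ, 3 ≤ k → Odd k →
      ∃ P : Finset Pt, P.card = 3 * k - 1 ∧ GenPos P ∧ SpokeSet P (3 * k / 2) ∧
        ∀ F : Finset (Pt × Pt), (∀ e ∈ F, e.1 ∈ P ∧ e.2 ∈ P) →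
          (∀ e ∈ F, ∀ f ∈ F, e ≠ f → SegCross e f) → F.card ≤ k := by

  intro k hk hodd
  obtain ⟨h, rfl⟩ := hodd
  refine ⟨Spoke.PP h, ?_, Spoke.PP_gen h, ?_, ?_⟩
  · rw [Spoke.PP_card]; omega
  · have : 3 * (2 * h + 1) / 2 = 3 * h + 1 := by omega
    rw [this]; exact Spoke.PP_spoke h
  · intro F hP hF
    exact Spoke.bound_main F hP hF
end
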